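/- Let M be a small elementary submodel of 𝕄, p(x) a type over M, q(x) a canonical coheir extension of p(x), and b₀,…,b_n a coheir sequence over M of realizations of p. Then there is a coheir tree in p indexed by ω^{≤n} such that every maximal path, read in the direction of the root, realizes tp(b₀…b_n/M), and every descending comb, read in lexicographic order, consists of initial terms of a canonical Morley sequence in q(x). -/

import Mathlib

/- Common model-theoretic infrastructure for formalizing
   "NSOP₂ theories are NSOP₁" (arXiv:2206.08512).

   We work with a monster model `𝕄` of a complete theory: a sufficiently
   saturated and strongly homogeneous `L`-structure.  Tuples are functions
   `α → 𝕄`; sets of formulas with parameters are coded via `FmlP`. -/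

open FirstOrder Language

universe u v w

namespace NSOP2Paper

/-- A first-order formula in free variables `α ⊕ Fin n` together with an
`n`-tuple of parameters from `𝕄`. -/
abbrev FmlP (L : FirstOrder.Language.{u, u}) (𝕄 : Type u) (α : Type v) :=
  Σ n : ℕ, L.Formula (α ⊕ Fin n) × (Fin n → 𝕄)

/-- `a ≡_C b` : the tuples `a` and `b` satisfy the same formulas with
parameters from `C`. -/
def EqTpOver (L : FirstOrder.Language.{u, u}) {𝕄 : Type u} [L.Structure 𝕄] (C : Set 𝕄)
    {α : Type v} (a b : α → 𝕄) : Prop :=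
  ∀ (n : ℕ) (φ : L.Formula (α ⊕ Fin n)) (c : Fin n → 𝕄), (∀ i, c i ∈ C) →
    (φ.Realize (Sum.elim a c) ↔ φ.Realize (Sum.elim b c))

/-- `tp(a / C)` is finitely satisfiable in `Ms`: every formula over `C`
satisfied by `a` has a realization by a tuple from `Ms`. -/
def FinSatIn (L : FirstOrder.Language.{u, u}) {𝕄 : Type u} [L.Structure 𝕄] (Ms : Set 𝕄)
    {α : Type v} (a : α → 𝕄) (C : Set 𝕄) : Prop :=
  ∀ (n : ℕ) (φ : L.Formula (α ⊕ Fin n)) (c : Fin n → 𝕄), (∀ i, c i ∈ C) →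
    φ.Realize (Sum.elim a c) →
    ∃ m : α → 𝕄, (∀ i, m i ∈ Ms) ∧ φ.Realize (Sum.elim m c)

/-- `Ms` is the underlying set of a (small) elementary submodel of `𝕄`. -/
def IsElemSubmodel (L : FirstOrder.Language.{u, u}) {𝕄 : Type u} [L.Structure 𝕄] (Ms : Set 𝕄) : Prop :=
  ∃ S : L.ElementarySubstructure 𝕄, (S : Set 𝕄) = Ms

/-- A complete consistent global type (a complete type over the monster `𝕄`)
in variables `α`, coded as the set of formulas-with-parameters it contains. -/
structure GlobalType (L : FirstOrder.Language.{u, u}) (𝕄 : Type u) [L.Structure 𝕄] (α : Type v) where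
  carrier : Set (FmlP L 𝕄 α)
  consistent : ∀ t : Finset (FmlP L 𝕄 α), ↑t ⊆ carrier →
    ∃ a : α → 𝕄, ∀ p ∈ t, p.2.1.Realize (Sum.elim a p.2.2)
  complete : ∀ (n : ℕ) (φ : L.Formula (α ⊕ Fin n)) (c : Fin n → 𝕄),
    (⟨n, (φ, c)⟩ : FmlP L 𝕄 α) ∈ carrier ∨ (⟨n, (φ.not, c)⟩ : FmlP L 𝕄 α) ∈ carrier

variable {L : FirstOrder.Language.{u, u}} {𝕄 : Type u} [L.Structure 𝕄]

/-- The global type `q` is finitely satisfiable in `Ms` (i.e. it is a coheir of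
its restriction to `Ms`). -/
def GlobalType.FinSatInM {α : Type v} (q : GlobalType L 𝕄 α) (Ms : Set 𝕄) : Prop :=
  ∀ t : Finset (FmlP L 𝕄 α), ↑t ⊆ q.carrier →
    ∃ m : α → 𝕄, (∀ i, m i ∈ Ms) ∧ ∀ p ∈ t, p.2.1.Realize (Sum.elim m p.2.2)

/-- `a ⊨ q|_C` : the tuple `a` realizes the restriction of the global type `q`
to parameters from `C`. -/
def RealizesType {α : Type v} (q : GlobalType L 𝕄 α) (a : α → 𝕄) (C : Set 𝕄) : Prop :=
  ∀ (n : ℕ) (φ : L.Formula (α ⊕ Fin n)) (c : Fin n → 𝕄), (∀ i, c i ∈ C) →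
    (⟨n, (φ, c)⟩ : FmlP L 𝕄 α) ∈ q.carrier → φ.Realize (Sum.elim a c)

/-- The global type `q` extends `tp(a / C)`. -/
def ExtendsTpOver {α : Type v} (q : GlobalType L 𝕄 α) (C : Set 𝕄) (a : α → 𝕄) : Prop :=
  ∀ (n : ℕ) (φ : L.Formula (α ⊕ Fin n)) (c : Fin n → 𝕄), (∀ i, c i ∈ C) →
    φ.Realize (Sum.elim a c) → (⟨n, (φ, c)⟩ : FmlP L 𝕄 α) ∈ q.carrier

/-- `B` is a coheir Morley sequence over `Ms` in the global type `q`: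
`q` is finitely satisfiable in `Ms` and `B i ⊨ q|_(Ms ∪ B_{<i})`. -/
def MorleyIn {α : Type v} (q : GlobalType L 𝕄 α) (Ms : Set 𝕄) (B : ℕ → α → 𝕄) : Prop :=
  q.FinSatInM Ms ∧
    ∀ i : ℕ, RealizesType q (B i) (Ms ∪ ⋃ (j : ℕ) (_ : j < i), Set.range (B j))

/-- `B` is a coheir Morley sequence over `Ms`. -/
def CoheirMorley (L : FirstOrder.Language.{u, u}) {𝕄 : Type u} [L.Structure 𝕄] (Ms : Set 𝕄)
    {α : Type v} (B : ℕ → α → 𝕄) : Prop :=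
  ∃ q : GlobalType L 𝕄 α, MorleyIn q Ms B

/-- Flatten an `ℕ`-indexed sequence of `α`-tuples into a single tuple. -/
def flatSeq {α : Type v} (I : ℕ → α → 𝕄) : ℕ × α → 𝕄 := fun p => I p.1 p.2

/-- The sequence `I` is indiscernible over `C`. -/
def IndiscernibleOver (L : FirstOrder.Language.{u, u}) {𝕄 : Type u} [L.Structure 𝕄] (C : Set 𝕄)
    {α : Type v} (I : ℕ → α → 𝕄) : Prop :=
  ∀ (n : ℕ) (f g : Fin n → ℕ), StrictMono f → StrictMono g →
    EqTpOver L C (fun p : Fin n × α => I (f p.1) p.2) (fun p : Fin n × α => I (g p.1) p.2)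

/-- `𝕄` is `κ`-saturated: every finitely satisfiable set of formulas in fewer
than `κ` variables over a parameter set of size `< κ` is realized in `𝕄`. -/
def IsSaturated (L : FirstOrder.Language.{u, u}) (𝕄 : Type u) [L.Structure 𝕄] (κ : Cardinal.{u}) : Prop :=
  ∀ (α : Type u) (A : Set 𝕄), Cardinal.mk α < κ → Cardinal.mk A < κ →
    ∀ Γ : Set (FmlP L 𝕄 α), (∀ p ∈ Γ, ∀ i, p.2.2 i ∈ A) →
      (∀ t : Finset (FmlP L 𝕄 α), ↑t ⊆ Γ →
        ∃ a : α → 𝕄, ∀ p ∈ t, p.2.1.Realize (Sum.elim a p.2.2)) →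
      ∃ a : α → 𝕄, ∀ p ∈ Γ, p.2.1.Realize (Sum.elim a p.2.2)

/-- `𝕄` is strongly `κ`-homogeneous: partial elementary maps between tuples of
length `< κ` extend to automorphisms of `𝕄`. -/
def IsStronglyHomogeneous (L : FirstOrder.Language.{u, u}) (𝕄 : Type u) [L.Structure 𝕄]
    (κ : Cardinal.{u}) : Prop :=
  ∀ (α : Type u), Cardinal.mk α < κ → ∀ a b : α → 𝕄, EqTpOver L (∅ : Set 𝕄) a b →
    ∃ σ : 𝕄 ≃[L] 𝕄, ∀ i, σ (a i) = b i

/-- `𝕄` is a monster model (for smallness degree `κ`): sufficiently saturated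
and strongly homogeneous. -/
def IsMonster (L : FirstOrder.Language.{u, u}) (𝕄 : Type u) [L.Structure 𝕄] (κ : Cardinal.{u}) : Prop :=
  Cardinal.aleph0 < κ ∧ IsSaturated L 𝕄 κ ∧ IsStronglyHomogeneous L 𝕄 κ

/-! ### Tree combinatorics -/

/-- The meet (longest common prefix) of two finite sequences. -/
def meet {A : Type w} [DecidableEq A] : List A → List A → List A
  | a :: as, b :: bs => if a = b then a :: meet as bs else []
  | _, _ => []

/-- The meet of `η 0, …, η i`. -/
def combMeet {A : Type w} [DecidableEq A] {k : ℕ} (η : Fin k → List A) (i : Fin k) : List A :=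
  (List.ofFn fun j : Fin i.val => η (Fin.castLE i.2.le j)).foldl meet (η i)

/-- `η 0, …, η (k-1)` is a descending comb: a lexicographically increasing
antichain such that the meet of `η 0, …, η (i+1)` is a proper initial segment
of the meet of `η 0, …, η i`. -/
def DescendingComb {A : Type w} [DecidableEq A] [LT A] {k : ℕ} (η : Fin k → List A) : Prop :=
  (∀ i j : Fin k, i ≠ j → ¬ η i <+: η j) ∧
  (∀ i j : Fin k, i < j → List.Lex (· < ·) (η i) (η j)) ∧
  (∀ (i : ℕ) (h : i + 1 < k),
    combMeet η ⟨i + 1, h⟩ <+: combMeet η ⟨i, by omega⟩ ∧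
    combMeet η ⟨i + 1, h⟩ ≠ combMeet η ⟨i, by omega⟩)

/-! ### Tree properties of theories (witnessed in the monster model) -/

/-- `T = Th(𝕄)` has `SOP₁`. -/
def HasSOP1 (L : FirstOrder.Language.{u, u}) (𝕄 : Type u) [L.Structure 𝕄] : Prop :=
  ∃ (k m : ℕ) (φ : L.Formula (Fin k ⊕ Fin m)) (b : List Bool → Fin m → 𝕄),
    (∀ σ : ℕ → Bool, ∃ a : Fin k → 𝕄,
      ∀ n : ℕ, φ.Realize (Sum.elim a (b (List.ofFn fun i : Fin n => σ i)))) ∧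
    ∀ η₁ η₂ : List Bool, (η₁ ++ [false]) <+: η₂ →
      ¬ ∃ a : Fin k → 𝕄, φ.Realize (Sum.elim a (b η₂)) ∧
        φ.Realize (Sum.elim a (b (η₁ ++ [true])))

/-- `T = Th(𝕄)` has `SOP₂`. -/
def HasSOP2 (L : FirstOrder.Language.{u, u}) (𝕄 : Type u) [L.Structure 𝕄] : Prop :=
  ∃ (k m : ℕ) (φ : L.Formula (Fin k ⊕ Fin m)) (b : List Bool → Fin m → 𝕄),
    (∀ σ : ℕ → Bool, ∃ a : Fin k → 𝕄,
      ∀ n : ℕ, φ.Realize (Sum.elim a (b (List.ofFn fun i : Fin n => σ i)))) ∧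
    ∀ η₁ η₂ : List Bool, ¬ η₁ <+: η₂ → ¬ η₂ <+: η₁ →
      ¬ ∃ a : Fin k → 𝕄, φ.Realize (Sum.elim a (b η₁)) ∧ φ.Realize (Sum.elim a (b η₂))

/-- `T = Th(𝕄)` has `k`-`DCTP₁`: paths are consistent but descending combs of
size `k` are inconsistent. -/
def HasKDCTP1 (L : FirstOrder.Language.{u, u}) (𝕄 : Type u) [L.Structure 𝕄] (k : ℕ) : Prop :=
  ∃ (r m : ℕ) (φ : L.Formula (Fin r ⊕ Fin m)) (b : List ℕ → Fin m → 𝕄),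
    (∀ σ : ℕ → ℕ, ∃ a : Fin r → 𝕄,
      ∀ n : ℕ, φ.Realize (Sum.elim a (b (List.ofFn fun i : Fin n => σ i)))) ∧
    ∀ η : Fin k → List ℕ, DescendingComb η →
      ¬ ∃ a : Fin r → 𝕄, ∀ i, φ.Realize (Sum.elim a (b (η i)))

/-- `T = Th(𝕄)` has weak `k`-`TP₁`: paths are consistent but any `k` pairwise
incomparable nodes with common pairwise meet are inconsistent. -/
def HasWeakKTP1 (L : FirstOrder.Language.{u, u}) (𝕄 : Type u) [L.Structure 𝕄] (k : ℕ) : Prop :=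
  ∃ (r m : ℕ) (φ : L.Formula (Fin r ⊕ Fin m)) (b : List ℕ → Fin m → 𝕄),
    (∀ σ : ℕ → ℕ, ∃ a : Fin r → 𝕄,
      ∀ n : ℕ, φ.Realize (Sum.elim a (b (List.ofFn fun i : Fin n => σ i)))) ∧
    ∀ η : Fin k → List ℕ,
      (∀ i j, i ≠ j → ¬ η i <+: η j) →
      (∀ i j i' j' : Fin k, i ≠ j → i' ≠ j' → meet (η i) (η j) = meet (η i') (η j')) →
      ¬ ∃ a : Fin r → 𝕄, ∀ i, φ.Realize (Sum.elim a (b (η i)))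

/-- `T = Th(𝕄)` has `k`-`DCTP₂`: paths are `k`-inconsistent but descending
combs are consistent. -/
def HasKDCTP2 (L : FirstOrder.Language.{u, u}) (𝕄 : Type u) [L.Structure 𝕄] (k : ℕ) : Prop :=
  ∃ (r m : ℕ) (φ : L.Formula (Fin r ⊕ Fin m)) (b : List Bool → Fin m → 𝕄),
    (∀ σ : ℕ → Bool, ∀ s : Finset ℕ, s.card = k →
      ¬ ∃ a : Fin r → 𝕄, ∀ n ∈ s,
        φ.Realize (Sum.elim a (b (List.ofFn fun i : Fin n => σ i)))) ∧
    ∀ (l : ℕ) (η : Fin l → List Bool), DescendingComb η →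
      ∃ a : Fin r → 𝕄, ∀ i, φ.Realize (Sum.elim a (b (η i)))

/-! ### Kim-dividing and Conant-dividing, with respect to coheir Morley sequences -/

/-- `φ(x, b)` Kim-divides over `Ms`: some coheir Morley sequence over `Ms`
starting with `b` makes it inconsistent. -/
def KimDivides (L : FirstOrder.Language.{u, u}) {𝕄 : Type u} [L.Structure 𝕄] (Ms : Set 𝕄)
    {α : Type v} {n : ℕ} (φ : L.Formula (α ⊕ Fin n)) (b : Fin n → 𝕄) : Prop :=
  ∃ B : ℕ → Fin n → 𝕄, CoheirMorley L Ms B ∧ B 0 = b ∧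
    ¬ ∃ a : α → 𝕄, ∀ i, φ.Realize (Sum.elim a (B i))

/-- `φ(x, b)` Kim-forks over `Ms`: it implies a finite disjunction of formulas
Kim-dividing over `Ms`. -/
def KimForks (L : FirstOrder.Language.{u, u}) {𝕄 : Type u} [L.Structure 𝕄] (Ms : Set 𝕄)
    {α : Type v} {n : ℕ} (φ : L.Formula (α ⊕ Fin n)) (b : Fin n → 𝕄) : Prop :=
  ∃ (N : ℕ) (m : Fin N → ℕ) (ψ : ∀ j : Fin N, L.Formula (α ⊕ Fin (m j)))
    (c : ∀ j : Fin N, Fin (m j) → 𝕄),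
    (∀ j, KimDivides L Ms (ψ j) (c j)) ∧
    ∀ a : α → 𝕄, φ.Realize (Sum.elim a b) → ∃ j, (ψ j).Realize (Sum.elim a (c j))

/-- `φ(x, b)` Conant-divides over `Ms`: every coheir Morley sequence over `Ms`
starting with `b` makes it inconsistent. -/
def ConantDivides (L : FirstOrder.Language.{u, u}) {𝕄 : Type u} [L.Structure 𝕄] (Ms : Set 𝕄)
    {α : Type v} {n : ℕ} (φ : L.Formula (α ⊕ Fin n)) (b : Fin n → 𝕄) : Prop :=
  ∀ B : ℕ → Fin n → 𝕄, CoheirMorley L Ms B → B 0 = b →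
    ¬ ∃ a : α → 𝕄, ∀ i, φ.Realize (Sum.elim a (B i))

/-- `φ(x, b)` Conant-forks over `Ms`. -/
def ConantForks (L : FirstOrder.Language.{u, u}) {𝕄 : Type u} [L.Structure 𝕄] (Ms : Set 𝕄)
    {α : Type v} {n : ℕ} (φ : L.Formula (α ⊕ Fin n)) (b : Fin n → 𝕄) : Prop :=
  ∃ (N : ℕ) (m : Fin N → ℕ) (ψ : ∀ j : Fin N, L.Formula (α ⊕ Fin (m j)))
    (c : ∀ j : Fin N, Fin (m j) → 𝕄),
    (∀ j, ConantDivides L Ms (ψ j) (c j)) ∧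
    ∀ a : α → 𝕄, φ.Realize (Sum.elim a b) → ∃ j, (ψ j).Realize (Sum.elim a (c j))

/-- `a ⫝^{K*}_{Ms} b` : `tp(a/Ms b)` contains no formula Conant-forking
over `Ms`. -/
def ConantIndep (L : FirstOrder.Language.{u, u}) {𝕄 : Type u} [L.Structure 𝕄] (Ms : Set 𝕄)
    {α : Type v} {β : Type w} (a : α → 𝕄) (b : β → 𝕄) : Prop :=
  ∀ (n : ℕ) (φ : L.Formula (α ⊕ Fin n)) (d : Fin n → 𝕄),
    (∀ i, d i ∈ Ms ∪ Set.range b) → φ.Realize (Sum.elim a d) →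
    ¬ ConantForks L Ms φ d

/-! ### Abstract independence relations between sets over models -/

/-- An abstract ternary relation `A ⫝_M B` between subsets of `𝕄` over
(elementary submodels of) `𝕄`. -/
structure IndRel (L : FirstOrder.Language.{u, u}) (𝕄 : Type u) [L.Structure 𝕄] where
  rel : Set 𝕄 → Set 𝕄 → Set 𝕄 → Prop

/-- A set `S` of `α`-tuples is type-definable over `C`. -/
def TypeDefinableOver (L : FirstOrder.Language.{u, u}) {𝕄 : Type u} [L.Structure 𝕄] (C : Set 𝕄)
    {γ : Type v} (S : Set (γ → 𝕄)) : Prop :=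
  ∃ Γ : Set (FmlP L 𝕄 γ), (∀ p ∈ Γ, ∀ i, p.2.2 i ∈ C) ∧
    ∀ g : γ → 𝕄, g ∈ S ↔ ∀ p ∈ Γ, p.2.1.Realize (Sum.elim g p.2.2)

namespace IndRel


/-- Invariance under automorphisms of `𝕄`. -/
def Invariant (R : IndRel L 𝕄) : Prop :=
  ∀ (σ : 𝕄 ≃[L] 𝕄) (A Ms B : Set 𝕄), R.rel A Ms B →
    R.rel ((⇑σ) '' A) ((⇑σ) '' Ms) ((⇑σ) '' B)

/-- Monotonicity (on both sides). -/
def Mono (R : IndRel L 𝕄) : Prop :=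
  ∀ (A A' Ms B B' : Set 𝕄), IsElemSubmodel L Ms → R.rel A Ms B →
    Ms ⊆ A' → A' ⊆ A → Ms ⊆ B' → B' ⊆ B → R.rel A' Ms B'

/-- Existence: for `M ⊆ A, B` there is `A' ≡_M A` with `A' ⫝_M B`. -/
def Existence (R : IndRel L 𝕄) (κ : Cardinal.{u}) : Prop :=
  ∀ (Ms : Set 𝕄), IsElemSubmodel L Ms → Cardinal.mk Ms < κ →
    ∀ (α β : Type u), Cardinal.mk α < κ → Cardinal.mk β < κ →
      ∀ (a : α → 𝕄) (b : β → 𝕄),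
        ∃ a' : α → 𝕄, EqTpOver L Ms a' a ∧
          R.rel (Ms ∪ Set.range a') Ms (Ms ∪ Set.range b)

/-- Right extension. -/
def RightExt (R : IndRel L 𝕄) (κ : Cardinal.{u}) : Prop :=
  ∀ (Ms : Set 𝕄), IsElemSubmodel L Ms → Cardinal.mk Ms < κ →
    ∀ (α : Type u), Cardinal.mk α < κ → ∀ (a : α → 𝕄) (B C : Set 𝕄),
      Cardinal.mk B < κ → Cardinal.mk C < κ →
      R.rel (Set.range a) Ms B → B ⊆ C →
      ∃ a' : α → 𝕄, EqTpOver L B a' a ∧ R.rel (Set.range a') Ms C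

/-- Quasi-strong finite character: for complete types `p = tp(a₀/Ms)` and
`q = tp(b₀/Ms)`, the set of pairs of realizations `(a, b)` with `a ⫝_Ms b`
is type-definable over `Ms`. -/
def QSFC (R : IndRel L 𝕄) (κ : Cardinal.{u}) : Prop :=
  ∀ (Ms : Set 𝕄), IsElemSubmodel L Ms → Cardinal.mk Ms < κ →
    ∀ (α β : Type u), Cardinal.mk α < κ → Cardinal.mk β < κ →
      ∀ (a₀ : α → 𝕄) (b₀ : β → 𝕄),
        TypeDefinableOver L Ms {g : (α ⊕ β) → 𝕄 |
          EqTpOver L Ms (g ∘ Sum.inl) a₀ ∧ EqTpOver L Ms (g ∘ Sum.inr) b₀ ∧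
          R.rel (Set.range (g ∘ Sum.inl)) Ms (Set.range (g ∘ Sum.inr))}

/-- The coheir chain condition. -/
def CoheirChain (R : IndRel L 𝕄) (κ : Cardinal.{u}) : Prop :=
  ∀ (Ms : Set 𝕄), IsElemSubmodel L Ms → Cardinal.mk Ms < κ →
    ∀ (α β : Type u), Cardinal.mk α < κ → Cardinal.mk β < κ →
      ∀ (a : α → 𝕄) (b : β → 𝕄), R.rel (Set.range a) Ms (Set.range b) →
        ∀ I : ℕ → β → 𝕄, CoheirMorley L Ms I → I 0 = b →
          ∃ I' : ℕ → β → 𝕄, EqTpOver L Ms (flatSeq I') (flatSeq I) ∧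
            R.rel (Set.range a) Ms (⋃ i, Set.range (I' i)) ∧
            ∀ i, EqTpOver L (Ms ∪ Set.range a) (I' i) b

/-- `R` implies `⫝ʰ` : `A ⫝_M B` implies `tp(B / M A)` is finitely
satisfiable in `M`. -/
def StrongerThanH (R : IndRel L 𝕄) : Prop :=
  ∀ (A Ms B : Set 𝕄), IsElemSubmodel L Ms → R.rel A Ms B →
    FinSatIn L Ms (fun x : B => (x : 𝕄)) (Ms ∪ A)

end IndRel

/-- The axioms satisfied by the relations among which `⫝^CK` is weakest. -/
def GoodRel (R : IndRel L 𝕄) (κ : Cardinal.{u}) : Prop :=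
  R.StrongerThanH ∧ R.Invariant ∧ R.Mono ∧ R.Existence κ ∧ R.RightExt κ ∧ R.CoheirChain κ

/-- `R` is `⫝^CK` : the weakest relation implying `⫝ʰ` and satisfying
invariance, monotonicity, existence, right extension and the coheir chain
condition. -/
def IsCK (R : IndRel L 𝕄) (κ : Cardinal.{u}) : Prop :=
  GoodRel R κ ∧ ∀ R' : IndRel L 𝕄, GoodRel R' κ →
    ∀ A Ms B : Set 𝕄, R'.rel A Ms B → R.rel A Ms B

/-- `q` is a canonical global type over `Ms` (w.r.t. the relation `R = ⫝^CK`):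
whenever `c ⊨ q|_{Ms b}` we have `b ⫝^CK_{Ms} c`. -/
def IsCanonicalGlobal (R : IndRel L 𝕄) (κ : Cardinal.{u}) (Ms : Set 𝕄) {α : Type v}
    (q : GlobalType L 𝕄 α) : Prop :=
  ∀ (β : Type u), Cardinal.mk β < κ → ∀ (b : β → 𝕄) (c : α → 𝕄),
    RealizesType q c (Ms ∪ Set.range b) → R.rel (Set.range b) Ms (Set.range c)

/-- A canonical Morley sequence over `Ms`: a coheir Morley sequence in a
canonical coheir. -/
def CanonicalMorley (R : IndRel L 𝕄) (κ : Cardinal.{u}) (Ms : Set 𝕄) {α : Type v}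
    (I : ℕ → α → 𝕄) : Prop :=
  ∃ q : GlobalType L 𝕄 α, IsCanonicalGlobal R κ Ms q ∧ MorleyIn q Ms I

/-- `q` is a strong canonical global type over `Ms`. -/
def IsStrongCanonical (R : IndRel L 𝕄) (κ : Cardinal.{u}) (Ms : Set 𝕄) {α : Type v}
    (q : GlobalType L 𝕄 α) : Prop :=
  ∀ (β : Type u), Cardinal.mk β < κ → ∀ (b : β → 𝕄) (c : α → 𝕄),
    RealizesType q c (Ms ∪ Set.range b) →
    ∀ (γ : Type u), Cardinal.mk γ < κ → ∀ (a : γ → 𝕄),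
      ∃ a' : γ → 𝕄, EqTpOver L (Ms ∪ Set.range c) a' a ∧
        ∃ q' : GlobalType L 𝕄 (γ ⊕ α), IsCanonicalGlobal R κ Ms q' ∧
          ExtendsTpOver q' (Ms ∪ Set.range b) (Sum.elim a' c)

/-! ### `M`-invariant ideals and `𝓘`-Kim-dividing -/

/-- An `Ms`-invariant ideal on the definable subsets of `𝕄` (in variables `α`). -/
structure InvIdeal (L : FirstOrder.Language.{u, u}) (𝕄 : Type u) [L.Structure 𝕄] (Ms : Set 𝕄)
    (α : Type v) where
  mem : Set (α → 𝕄) → Prop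
  definable_of_mem : ∀ S, mem S → ∃ (n : ℕ) (ψ : L.Formula (α ⊕ Fin n)) (c : Fin n → 𝕄),
    S = {a : α → 𝕄 | ψ.Realize (Sum.elim a c)}
  union_mem : ∀ S T, mem S → mem T → mem (S ∪ T)
  subset_mem : ∀ S T, mem S →
    (∃ (n : ℕ) (ψ : L.Formula (α ⊕ Fin n)) (c : Fin n → 𝕄),
      T = {a : α → 𝕄 | ψ.Realize (Sum.elim a c)}) →
    T ⊆ S → mem T
  invariant : ∀ σ : 𝕄 ≃[L] 𝕄, (∀ x ∈ Ms, σ x = x) → ∀ S, mem S →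
    mem ((fun a => (⇑σ) ∘ a) '' S)

/-- `φ(x, b)` `𝓘`-Kim-divides over `Ms`. -/
def IKimDivides {Ms : Set 𝕄} {α : Type v} (I : InvIdeal L 𝕄 Ms α) {n : ℕ}
    (φ : L.Formula (α ⊕ Fin n)) (b : Fin n → 𝕄) : Prop :=
  ∃ (B : ℕ → Fin n → 𝕄) (k : ℕ), CoheirMorley L Ms B ∧ B 0 = b ∧ 0 < k ∧
    ∀ s : Finset ℕ, s.card = k →
      I.mem {a : α → 𝕄 | ∀ i ∈ s, φ.Realize (Sum.elim a (B i))}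

/-- `φ(x, b)` `𝓘`-Kim-forks over `Ms`. -/
def IKimForks {Ms : Set 𝕄} {α : Type v} (I : InvIdeal L 𝕄 Ms α) {n : ℕ}
    (φ : L.Formula (α ⊕ Fin n)) (b : Fin n → 𝕄) : Prop :=
  ∃ (N : ℕ) (m : Fin N → ℕ) (ψ : ∀ j : Fin N, L.Formula (α ⊕ Fin (m j)))
    (c : ∀ j : Fin N, Fin (m j) → 𝕄),
    (∀ j, IKimDivides I (ψ j) (c j)) ∧
    ∀ a : α → 𝕄, φ.Realize (Sum.elim a b) → ∃ j, (ψ j).Realize (Sum.elim a (c j))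

/-- `φ(x, b)` `𝓘`-quasi-divides over `Ms`. -/
def IQuasiDivides {Ms : Set 𝕄} {α : Type v} (I : InvIdeal L 𝕄 Ms α) {n : ℕ}
    (φ : L.Formula (α ⊕ Fin n)) (b : Fin n → 𝕄) : Prop :=
  ∃ (mm : ℕ) (b' : Fin mm → Fin n → 𝕄), 0 < mm ∧ (∀ j, EqTpOver L Ms (b' j) b) ∧
    I.mem {a : α → 𝕄 | ∀ j, φ.Realize (Sum.elim a (b' j))}

/-! ### `h^⫝`-inconsistency and the derived relation `⫝'` -/

/-- A family of formulas is `h^⫝`-inconsistent with respect to `P = tp(a₀/Ms)`. -/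
def HInconsistent (R : IndRel L 𝕄) (Ms : Set 𝕄) {α : Type v} (a₀ : α → 𝕄)
    {ι : Type w} (m : ι → ℕ) (φ : ∀ i : ι, L.Formula (α ⊕ Fin (m i)))
    (b : ∀ i : ι, Fin (m i) → 𝕄) : Prop :=
  ¬ ∃ a : α → 𝕄, EqTpOver L Ms a a₀ ∧
      R.rel (Set.range a) Ms (⋃ i, Set.range (b i)) ∧
      ∀ i, (φ i).Realize (Sum.elim a (b i))

/-- A single formula is `h^⫝`-inconsistent with respect to `P = tp(a₀/Ms)`. -/
def HInconsistentSingle (R : IndRel L 𝕄) (Ms : Set 𝕄) {α : Type v} (a₀ : α → 𝕄)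
    {n : ℕ} (φ : L.Formula (α ⊕ Fin n)) (b : Fin n → 𝕄) : Prop :=
  ¬ ∃ a : α → 𝕄, EqTpOver L Ms a a₀ ∧ R.rel (Set.range a) Ms (Set.range b) ∧
      φ.Realize (Sum.elim a b)

/-- `φ(x, b)` `h^⫝`-Kim-divides with respect to `tp(a₀/Ms)`. -/
def HKimDivides (R : IndRel L 𝕄) (Ms : Set 𝕄) {α : Type v} (a₀ : α → 𝕄)
    {n : ℕ} (φ : L.Formula (α ⊕ Fin n)) (b : Fin n → 𝕄) : Prop :=
  ∃ B : ℕ → Fin n → 𝕄, CoheirMorley L Ms B ∧ B 0 = b ∧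
    HInconsistent R Ms a₀ (fun _ : ℕ => n) (fun _ => φ) B

/-- `φ(x, b)` `h^⫝`-Kim-forks with respect to `tp(a₀/Ms)`. -/
def HKimForks (R : IndRel L 𝕄) (Ms : Set 𝕄) {α : Type v} (a₀ : α → 𝕄)
    {n : ℕ} (φ : L.Formula (α ⊕ Fin n)) (b : Fin n → 𝕄) : Prop :=
  ∃ (N : ℕ) (m : Fin N → ℕ) (ψ : ∀ j : Fin N, L.Formula (α ⊕ Fin (m j)))
    (c : ∀ j : Fin N, Fin (m j) → 𝕄),
    (∀ j, HKimDivides R Ms a₀ (ψ j) (c j)) ∧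
    ∀ a : α → 𝕄, φ.Realize (Sum.elim a b) → ∃ j, (ψ j).Realize (Sum.elim a (c j))

/-- `φ(x, b)` `h^⫝`-quasi-divides with respect to `tp(a₀/Ms)`. -/
def HQuasiDivides (R : IndRel L 𝕄) (Ms : Set 𝕄) {α : Type v} (a₀ : α → 𝕄)
    {n : ℕ} (φ : L.Formula (α ⊕ Fin n)) (b : Fin n → 𝕄) : Prop :=
  ∃ (mm : ℕ) (b' : Fin mm → Fin n → 𝕄), 0 < mm ∧ (∀ j, EqTpOver L Ms (b' j) b) ∧
    HInconsistent R Ms a₀ (fun _ : Fin mm => n) (fun _ => φ) b'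

/-- The derived relation `⫝'` on tuples:
`tp(a / Ms b)` contains no formula `h^⫝`-Kim-forking w.r.t. `tp(a/Ms)`. -/
def DerivedIndep (R : IndRel L 𝕄) (Ms : Set 𝕄) {α : Type v} {β : Type w}
    (a : α → 𝕄) (b : β → 𝕄) : Prop :=
  ∀ (n : ℕ) (φ : L.Formula (α ⊕ Fin n)) (d : Fin n → 𝕄),
    (∀ i, d i ∈ Ms ∪ Set.range b) → φ.Realize (Sum.elim a d) →
    ¬ HKimForks R Ms a φ d

/-- The derived relation `⫝'` as a relation between sets over models. -/
def derived (R : IndRel L 𝕄) : IndRel L 𝕄 where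
  rel A Ms B := ∀ (n : ℕ) (φ : L.Formula (↥A ⊕ Fin n)) (d : Fin n → 𝕄),
    (∀ i, d i ∈ Ms ∪ B) → φ.Realize (Sum.elim (fun x : A => (x : 𝕄)) d) →
    ¬ HKimForks R Ms (fun x : A => (x : 𝕄)) φ d

/-! ### Coheir trees -/

/-- The tuple, indexed by extensions, consisting of the part of the tree `c`
lying (weakly) above the node `ν` (where `ν` has length `Lh`). -/
def subtreeTupleLen {α : Type v} {n : ℕ} (c : {l : List ℕ // l.length ≤ n} → α → 𝕄)
    (Lh : ℕ) (ν : List ℕ) (hν : ν.length = Lh) :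
    ({s : List ℕ // Lh + s.length ≤ n} × α) → 𝕄 :=
  fun p => c ⟨ν ++ p.1.1, by rw [List.length_append, hν]; exact p.1.2⟩ p.2

end NSOP2Paper
namespace NSOP2Paper

section CoheirTreeConstruction

open FirstOrder.Language

variable {L : FirstOrder.Language.{u, u}} {𝕄 : Type u} [L.Structure 𝕄]
variable {α ξ : Type u} {Ms : Set 𝕄}

/-! ### Formulas with finitely many parameters -/

/-- Only finitely many of the variables in `ι` occur in a formula. -/
theorem exists_fin_params {α : Type v} {ι : Type w} (ψ : L.Formula (α ⊕ ι)) :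
    ∃ (n : ℕ) (φ : L.Formula (α ⊕ Fin n)) (g : Fin n → ι), Function.Injective g ∧
      ∀ (N : Type u) [L.Structure N] (x : α → N) (e : ι → N),
        ψ.Realize (Sum.elim x e) ↔ φ.Realize (Sum.elim x (e ∘ g)) := by
  classical
  have hfin : Finite {i : ι // Sum.inr i ∈ ψ.freeVarFinset} :=
    Finite.of_injective (β := ψ.freeVarFinset) (fun i => ⟨Sum.inr i.1, i.2⟩)
      fun i j h => Subtype.ext (Sum.inr_injective (congrArg Subtype.val h))
  obtain ⟨n, ⟨f⟩⟩ := Finite.exists_equiv_fin {i : ι // Sum.inr i ∈ ψ.freeVarFinset}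
  let r : ψ.freeVarFinset → α ⊕ Fin n := fun v => match v with
    | ⟨Sum.inl a, _⟩ => Sum.inl a
    | ⟨Sum.inr i, h⟩ => Sum.inr (f ⟨i, h⟩)
  refine ⟨n, ψ.restrictFreeVar r, fun i => (f.symm i).1,
    Subtype.val_injective.comp f.symm.injective, fun N _ x e => ?_⟩
  refine (BoundedFormula.realize_restrictFreeVar (Sum.elim x e) ?_).symm
  rintro ⟨a | i, h⟩ <;> simp [r]

/-- Existential quantification over the coordinates outside the range of `e`. -/
theorem exists_projection_formula {e : α → ξ} (he : Function.Injective e) {n : ℕ}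
    (φ : L.Formula (ξ ⊕ Fin n)) :
    ∃ θ : L.Formula (α ⊕ Fin n),
      ∀ (N : Type u) [L.Structure N], (ξ → Nonempty N) → ∀ (x : α → N) (c : Fin n → N),
        θ.Realize (Sum.elim x c) ↔ ∃ y : ξ → N, y ∘ e = x ∧ φ.Realize (Sum.elim y c) := by
  classical
  let s : ξ → α ⊕ ξ := fun z => if h : ∃ a, e a = z then Sum.inl h.choose else Sum.inr z
  have hs : ∀ a, s (e a) = Sum.inl a := fun a => by
    have h : ∃ a', e a' = e a := ⟨a, rfl⟩
    simp only [s, dif_pos h]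
    exact congrArg _ (he h.choose_spec)
  let g : ξ ⊕ Fin n → (α ⊕ Fin n) ⊕ ξ :=
    Sum.elim (fun z => Sum.map Sum.inl id (s z)) (fun i => Sum.inl (Sum.inr i))
  obtain ⟨m, φ', k, hk, hφ'⟩ := exists_fin_params (φ.relabel g)
  refine ⟨φ'.iExs (Fin m), fun N _ hN x c => ?_⟩
  have key : ∀ w : ξ → N, (Sum.elim (Sum.elim x c) w) ∘ g =
      Sum.elim (fun z => Sum.elim x w (s z)) c := by
    intro w
    funext z
    rcases z with z | i
    · simp only [g, Function.comp, Sum.elim_inl]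
      rcases s z with a | z <;> rfl
    · rfl
  rw [Formula.realize_iExs]
  constructor
  · rintro ⟨i, hi⟩
    let w : ξ → N := fun z => if h : ∃ j, k j = z then i h.choose else (hN z).some
    have hw : w ∘ k = i := by
      funext j
      have h : ∃ j', k j' = k j := ⟨j, rfl⟩
      simp only [w, Function.comp, dif_pos h]
      exact congrArg i (hk h.choose_spec)
    have h := (hφ' N (Sum.elim x c) w).2 (by rwa [hw])
    rw [Formula.realize_relabel, key] at h
    exact ⟨_, funext fun a => by simp [hs], h⟩
  · rintro ⟨y, rfl, hy⟩
    refine ⟨y ∘ k, (hφ' N _ y).1 ?_⟩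
    rw [Formula.realize_relabel, key]
    convert hy using 2
    funext z
    simp only [s]
    split_ifs with h
    · simpa using congrArg y h.choose_spec
    · rfl

/-! ### Equality of types over a base -/

namespace EqTpOver

theorem symm {α : Type v} {C : Set 𝕄} {a b : α → 𝕄} (h : EqTpOver L C a b) :
    EqTpOver L C b a :=
  fun n φ c hc => (h n φ c hc).symm

theorem trans {α : Type v} {C : Set 𝕄} {a b d : α → 𝕄} (h : EqTpOver L C a b)
    (h' : EqTpOver L C b d) : EqTpOver L C a d :=
  fun n φ c hc => (h n φ c hc).trans (h' n φ c hc)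

/-- Types over a base determine the truth of formulas with any family of parameters from it. -/
theorem realize_iff {α : Type v} {ι : Type w} {C : Set 𝕄} {a b : α → 𝕄}
    (h : EqTpOver L C a b) (φ : L.Formula (α ⊕ ι)) (c : ι → 𝕄) (hc : ∀ i, c i ∈ C) :
    φ.Realize (Sum.elim a c) ↔ φ.Realize (Sum.elim b c) := by
  obtain ⟨n, ψ, g, -, hψ⟩ := exists_fin_params φ
  rw [hψ, hψ]
  exact h n ψ _ fun i => hc (g i)

theorem comp {α : Type v} {β : Type w} {C : Set 𝕄} {a b : α → 𝕄} (h : EqTpOver L C a b)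
    (e : β → α) : EqTpOver L C (a ∘ e) (b ∘ e) := by
  intro n φ c hc
  simpa [Formula.realize_relabel, Sum.elim_comp_map] using h n (φ.relabel (Sum.map e id)) c hc

end EqTpOver

/-- Automorphisms fixing the base pointwise preserve types over it. -/
theorem eqTpOver_equiv {α : Type v} (σ : 𝕄 ≃[L] 𝕄) (hσ : ∀ m ∈ Ms, σ m = m) (a : α → 𝕄) :
    EqTpOver L Ms (σ ∘ a) a := by
  intro n φ c hc
  rw [← StrongHomClass.realize_formula σ φ (v := Sum.elim a c), Sum.comp_elim]
  have : σ ∘ c = c := funext fun i => hσ _ (hc i)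
  rw [this]

/-- In a monster model, tuples with the same type over a small base are conjugate over it. -/
theorem exists_equiv_of_eqTpOver {κ : Cardinal.{u}} (hmonster : IsMonster L 𝕄 κ)
    (hMs : Cardinal.mk Ms < κ) (hξ : Cardinal.mk ξ < κ) {a b : ξ → 𝕄}
    (h : EqTpOver L Ms a b) :
    ∃ σ : 𝕄 ≃[L] 𝕄, (∀ m ∈ Ms, σ m = m) ∧ σ ∘ a = b := by
  obtain ⟨σ, hσ⟩ := hmonster.2.2 (ξ ⊕ Ms)
    (by simpa using Cardinal.add_lt_of_lt hmonster.1.le hξ hMs)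
    (Sum.elim a (↑)) (Sum.elim b (↑)) (by
      intro n φ c hc
      have := h.realize_iff (ι := Ms ⊕ Fin n)
        (φ.relabel (Sum.elim (Sum.map id Sum.inl) (fun i => Sum.inr (Sum.inr i))))
        (Sum.elim (↑) c) (by rintro (m | i); exacts [m.2, (hc i).elim])
      rw [Formula.realize_relabel, Formula.realize_relabel] at this
      convert this using 2 <;> (funext z; rcases z with (z | z) | z <;> rfl))
  exact ⟨σ, fun m hm => hσ (Sum.inr ⟨m, hm⟩), funext fun i => hσ (Sum.inl i)⟩

/-! ### Global types -/

/-- The formula with parameters obtained by substituting variables along `e`. -/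
def FmlP.subst {α : Type v} {β : Type w} (e : α → β) (p : FmlP L 𝕄 α) : FmlP L 𝕄 β :=
  ⟨p.1, p.2.1.relabel (Sum.map e id), p.2.2⟩

theorem FmlP.realize_subst {α : Type v} {β : Type w} (e : α → β) (p : FmlP L 𝕄 α) (y : β → 𝕄) :
    (p.subst e).2.1.Realize (Sum.elim y (p.subst e).2.2) ↔
      p.2.1.Realize (Sum.elim (y ∘ e) p.2.2) := by
  simp [FmlP.subst, Formula.realize_relabel, Sum.elim_comp_map]

/-- Finitely many formulas with parameters are equivalent to a single one. -/
theorem exists_conj {α : Type v} (t : Finset (FmlP L 𝕄 α)) :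
    ∃ p : FmlP L 𝕄 α, (∀ i, ∃ p' ∈ t, ∃ j, p.2.2 i = p'.2.2 j) ∧
      ∀ a : α → 𝕄, p.2.1.Realize (Sum.elim a p.2.2) ↔
        ∀ p' ∈ t, p'.2.1.Realize (Sum.elim a p'.2.2) := by
  classical
  let ι := Σ p : t, Fin p.1.1
  obtain ⟨n, φ, g, -, hφ⟩ := exists_fin_params (L := L) (α := α) (ι := ι)
    (Formula.iInf fun p : t => p.1.2.1.relabel (Sum.map id fun i => (⟨p, i⟩ : ι)))
  refine ⟨⟨n, φ, fun i => (g i).1.1.2.2 (g i).2⟩, fun i => ⟨_, (g i).1.2, _, rfl⟩, fun a => ?_⟩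
  have := hφ 𝕄 a (fun i : ι => i.1.1.2.2 i.2)
  refine this.symm.trans ?_
  simp only [Formula.realize_iInf, Formula.realize_relabel, Sum.elim_comp_map, Subtype.forall]
  rfl

theorem FinSatIn.exists_of_finset {α : Type v} {a : α → 𝕄} {C : Set 𝕄} (h : FinSatIn L Ms a C)
    (t : Finset (FmlP L 𝕄 α)) (htC : ∀ p ∈ t, ∀ i, p.2.2 i ∈ C)
    (hta : ∀ p ∈ t, p.2.1.Realize (Sum.elim a p.2.2)) :
    ∃ m : α → 𝕄, (∀ i, m i ∈ Ms) ∧ ∀ p ∈ t, p.2.1.Realize (Sum.elim m p.2.2) := by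
  obtain ⟨p, hp, hp'⟩ := exists_conj t
  obtain ⟨m, hm, hpm⟩ := h p.1 p.2.1 p.2.2
    (fun i => by obtain ⟨p', hp't, j, e⟩ := hp i; rw [e]; exact htC p' hp't j) ((hp' a).2 hta)
  exact ⟨m, hm, (hp' m).1 hpm⟩

theorem FinSatIn.comp {α : Type v} {β : Type w} {a : α → 𝕄} {C : Set 𝕄} (h : FinSatIn L Ms a C)
    (e : β → α) : FinSatIn L Ms (a ∘ e) C := by
  intro n φ c hc hφ
  obtain ⟨m, hm, hm'⟩ := h n (φ.relabel (Sum.map e id)) c hc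
    (by simpa [Formula.realize_relabel, Sum.elim_comp_map] using hφ)
  exact ⟨m ∘ e, fun i => hm _, by simpa [Formula.realize_relabel, Sum.elim_comp_map] using hm'⟩

/-- A set of formulas finitely satisfiable in `Ms` extends to a global type with this property. -/
theorem exists_globalType {α : Type v} (Γ : Set (FmlP L 𝕄 α))
    (hΓ : ∀ t : Finset (FmlP L 𝕄 α), ↑t ⊆ Γ →
      ∃ m : α → 𝕄, (∀ i, m i ∈ Ms) ∧ ∀ p ∈ t, p.2.1.Realize (Sum.elim m p.2.2)) :
    ∃ r : GlobalType L 𝕄 α, r.FinSatInM Ms ∧ Γ ⊆ r.carrier := by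
  classical
  let A : FmlP L 𝕄 α → Set {m : α → 𝕄 // ∀ i, m i ∈ Ms} :=
    fun p => {m | p.2.1.Realize (Sum.elim m.1 p.2.2)}
  have hne : (Filter.generate (A '' Γ)).NeBot := by
    rw [Filter.generate_neBot_iff]
    intro s hs hfin
    obtain ⟨s, rfl⟩ := hfin.exists_finset_coe
    obtain ⟨t, ht, rfl⟩ := Finset.subset_set_image_iff.1 hs
    obtain ⟨m, hm, hmt⟩ := hΓ t ht
    refine ⟨⟨m, hm⟩, ?_⟩
    simpa [A] using hmt
  let U := Ultrafilter.of (Filter.generate (A '' Γ))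
  have hfin : ∀ t : Finset (FmlP L 𝕄 α), ↑t ⊆ {p | A p ∈ U} →
      ∃ m : α → 𝕄, (∀ i, m i ∈ Ms) ∧ ∀ p ∈ t, p.2.1.Realize (Sum.elim m p.2.2) := by
    intro t ht
    have : (⋂ p ∈ t, A p) ∈ (U : Filter _) := (Filter.biInter_finset_mem t).2 fun p hp => ht hp
    obtain ⟨m, hm⟩ := Filter.nonempty_of_mem this
    exact ⟨m.1, m.2, fun p hp => (Set.mem_iInter₂.1 hm p hp :)⟩
  refine ⟨⟨{p | A p ∈ U}, fun t ht => (hfin t ht).imp fun m hm => hm.2, fun n φ c => ?_⟩,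
    hfin, fun p hp => ?_⟩
  · exact U.mem_or_compl_mem (A ⟨n, φ, c⟩)
  · exact Ultrafilter.of_le _ (Filter.mem_generate_of_mem (Set.mem_image_of_mem A hp))

theorem RealizesType.mono {α : Type v} {q : GlobalType L 𝕄 α} {a : α → 𝕄} {C D : Set 𝕄}
    (h : RealizesType q a D) (hCD : C ⊆ D) : RealizesType q a C :=
  fun n φ c hc => h n φ c fun i => hCD (hc i)

theorem RealizesType.not_mem {α : Type v} {q : GlobalType L 𝕄 α} {a : α → 𝕄} {C : Set 𝕄}
    (h : RealizesType q a C) {n : ℕ} {φ : L.Formula (α ⊕ Fin n)} {c : Fin n → 𝕄}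
    (hc : ∀ i, c i ∈ C) (hφ : ¬ φ.Realize (Sum.elim a c)) :
    (⟨n, (φ.not, c)⟩ : FmlP L 𝕄 α) ∈ q.carrier :=
  (q.complete n φ c).resolve_left fun hq => hφ (h n φ c hc hq)

theorem RealizesType.mem {α : Type v} {q : GlobalType L 𝕄 α} {a : α → 𝕄} {C : Set 𝕄}
    (h : RealizesType q a C) {n : ℕ} {φ : L.Formula (α ⊕ Fin n)} {c : Fin n → 𝕄}
    (hc : ∀ i, c i ∈ C) (hφ : φ.Realize (Sum.elim a c)) :
    (⟨n, (φ, c)⟩ : FmlP L 𝕄 α) ∈ q.carrier :=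
  (q.complete n φ c).resolve_right fun hq => h n φ.not c hc hq hφ

theorem RealizesType.eqTpOver {α : Type v} {q : GlobalType L 𝕄 α} {a b : α → 𝕄} {C D : Set 𝕄}
    (h : RealizesType q a D) (hCD : C ⊆ D) (hb : ExtendsTpOver q C b) : EqTpOver L C a b := by
  refine fun n φ c hc => ⟨fun ha => ?_, fun hφ => h n φ c (fun i => hCD (hc i)) (hb n φ c hc hφ)⟩
  by_contra hφ
  exact h n φ.not c (fun i => hCD (hc i)) (hb n φ.not c hc hφ) ha

theorem ExtendsTpOver.congr {α : Type v} {q : GlobalType L 𝕄 α} {a b : α → 𝕄} {C : Set 𝕄}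
    (h : ExtendsTpOver q C a) (hab : EqTpOver L C b a) : ExtendsTpOver q C b :=
  fun n φ c hc hb => h n φ c hc ((hab n φ c hc).1 hb)

theorem ExtendsTpOver.mono {α : Type v} {q : GlobalType L 𝕄 α} {a : α → 𝕄} {C D : Set 𝕄}
    (h : ExtendsTpOver q D a) (hCD : C ⊆ D) : ExtendsTpOver q C a :=
  fun n φ c hc => h n φ c fun i => hCD (hc i)

theorem GlobalType.FinSatInM.exists_pair {α : Type v} {q : GlobalType L 𝕄 α}
    (hq : q.FinSatInM Ms) {p p' : FmlP L 𝕄 α} (hp : p ∈ q.carrier) (hp' : p' ∈ q.carrier) :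
    ∃ m : α → 𝕄, (∀ i, m i ∈ Ms) ∧ p.2.1.Realize (Sum.elim m p.2.2) ∧
      p'.2.1.Realize (Sum.elim m p'.2.2) := by
  classical
  obtain ⟨m, hm, h⟩ := hq {p, p'} (by simp [Set.insert_subset_iff, hp, hp'])
  exact ⟨m, hm, h p (by simp), h p' (by simp)⟩

/-- Realizing a global type finitely satisfiable in `Ms` over part of a tuple only depends on the
type of the tuple over `Ms`. -/
theorem RealizesType.transport {α : Type v} {ζ : Type w} {q : GlobalType L 𝕄 α}
    (hq : q.FinSatInM Ms) {Y Y' : ζ → 𝕄} (hY : EqTpOver L Ms Y Y') (e : α → ζ) (S : Set ζ)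
    (h : RealizesType q (Y ∘ e) (Ms ∪ Y '' S)) : RealizesType q (Y' ∘ e) (Ms ∪ Y' '' S) := by
  intro n φ c' hc' hφ
  by_contra hn
  have hg : ∀ i, ∃ z : S ⊕ Ms, c' i = Sum.elim (fun s : S => Y' s) (fun m : Ms => (m : 𝕄)) z := by
    intro i
    rcases hc' i with hi | ⟨z, hz, hi⟩
    · exact ⟨Sum.inr ⟨_, hi⟩, rfl⟩
    · exact ⟨Sum.inl ⟨z, hz⟩, hi.symm⟩
  choose g hg using hg
  let c : Fin n → 𝕄 := fun i => Sum.elim (fun s : S => Y s) (fun m : Ms => (m : 𝕄)) (g i)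
  have hc : ∀ i, c i ∈ Ms ∪ Y '' S := by
    intro i
    simp only [c]
    rcases g i with s | m
    · exact Or.inr ⟨s, s.2, rfl⟩
    · exact Or.inl m.2
  have hx : φ.Realize (Sum.elim (Y ∘ e) c) ↔ φ.Realize (Sum.elim (Y' ∘ e) c') := by
    have := hY.realize_iff (ι := Ms) (φ.relabel
      (Sum.elim (fun a => Sum.inl (e a)) (fun i => Sum.map (fun s : S => (s : ζ)) id (g i))))
      (fun m => m) fun m => m.2
    rw [Formula.realize_relabel, Formula.realize_relabel] at this
    convert this using 2
    · funext z
      rcases z with a | i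
      · rfl
      · simp only [c, Function.comp, Sum.elim_inr]
        rcases g i with s | m <;> rfl
    · funext z
      rcases z with a | i
      · rfl
      · simp only [Function.comp, Sum.elim_inr, hg]
        rcases g i with s | m <;> rfl
  obtain ⟨m, hm, hm₁, hm₂⟩ := hq.exists_pair hφ (h.not_mem hc fun hr => hn (hx.1 hr))
  refine hm₂ (show φ.Realize (Sum.elim m c) from ?_)
  have := hY.realize_iff (ι := α ⊕ Ms) (φ.relabel (Sum.elim (fun a => Sum.inr (Sum.inl a))
      (fun i => Sum.map (fun s : S => (s : ζ)) Sum.inr (g i))))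
      (Sum.elim m (fun m : Ms => m)) (by rintro (a | a); exacts [hm a, a.2])
  rw [Formula.realize_relabel, Formula.realize_relabel] at this
  convert this.2 ?_ using 2
  · funext z
    rcases z with a | i
    · rfl
    · simp only [c, Function.comp, Sum.elim_inr]
      rcases g i with s | m <;> rfl
  · convert hm₁ using 2
    funext z
    rcases z with a | i
    · rfl
    · simp only [Function.comp, Sum.elim_inr, hg]
      rcases g i with s | m <;> rfl

/-- Global types finitely satisfiable in `Ms` are stationary over `Ms`. -/
theorem RealizesType.eqTpOver_sumElim {α : Type v} {β : Type w} {q : GlobalType L 𝕄 α}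
    (hq : q.FinSatInM Ms) {x x' : α → 𝕄} {d d' : β → 𝕄} (hd : EqTpOver L Ms d d')
    (hx : RealizesType q x (Ms ∪ Set.range d)) (hx' : RealizesType q x' (Ms ∪ Set.range d')) :
    EqTpOver L Ms (Sum.elim x d) (Sum.elim x' d') := by
  have main : ∀ {x x' : α → 𝕄} {d d' : β → 𝕄}, EqTpOver L Ms d d' →
      RealizesType q x (Ms ∪ Set.range d) → RealizesType q x' (Ms ∪ Set.range d') →
      ∀ (n : ℕ) (φ : L.Formula ((α ⊕ β) ⊕ Fin n)) (c : Fin n → 𝕄), (∀ i, c i ∈ Ms) →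
        φ.Realize (Sum.elim (Sum.elim x d) c) → φ.Realize (Sum.elim (Sum.elim x' d') c) := by
    intro x x' d d' hd hx hx' n φ c hc hφ
    obtain ⟨k, ψ, g, -, hψ⟩ := exists_fin_params
      (φ.relabel (Equiv.sumAssoc α β (Fin n)))
    have hψ' : ∀ (y : α → 𝕄) (b : β → 𝕄), φ.Realize (Sum.elim (Sum.elim y b) c) ↔
        ψ.Realize (Sum.elim y (Sum.elim b c ∘ g)) := by
      intro y b
      rw [← hψ, Formula.realize_relabel]
      apply iff_of_eq
      congr 1
      funext z
      rcases z with (z | z) | z <;> rfl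
    by_contra hn
    have hmem : ∀ (b : β → 𝕄) (i : Fin k), (Sum.elim b c ∘ g) i ∈ Ms ∪ Set.range b := by
      intro b i
      simp only [Function.comp]
      rcases g i with z | z
      · exact Or.inr ⟨z, rfl⟩
      · exact Or.inl (hc z)
    obtain ⟨m, hm, hm₁, hm₂⟩ := hq.exists_pair (hx.mem (hmem d) ((hψ' x d).1 hφ))
      (hx'.not_mem (hmem d') fun h => hn ((hψ' x' d').2 h))
    refine hm₂ ((hψ' m d').1 ?_)
    have := hd.realize_iff (ι := α ⊕ Fin n) (φ.relabel
      (Sum.elim (Sum.elim (fun a => Sum.inr (Sum.inl a)) Sum.inl) fun i => Sum.inr (Sum.inr i)))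
      (Sum.elim m c) (by rintro (a | a); exacts [hm a, hc a])
    rw [Formula.realize_relabel, Formula.realize_relabel] at this
    convert this.1 ?_ using 2
    · funext z
      rcases z with (z | z) | z <;> rfl
    · convert (hψ' m d).2 hm₁ using 2
      funext z
      rcases z with (z | z) | z <;> rfl
  exact fun n φ c hc => ⟨main hd hx hx' n φ c hc, main hd.symm hx' hx n φ c hc⟩

/-- The pullback of a global type along a map of variables. -/
def GlobalType.comap {α : Type v} {β : Type w} (e : α → β) (q : GlobalType L 𝕄 β) :
    GlobalType L 𝕄 α where
  carrier := {p | p.subst e ∈ q.carrier}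
  consistent := by
    classical
    intro t ht
    obtain ⟨a, ha⟩ := q.consistent (t.image (FmlP.subst e))
      (by rw [Finset.coe_image]; exact Set.image_subset_iff.2 ht)
    exact ⟨a ∘ e, fun p hp => (p.realize_subst e a).1 (ha _ (Finset.mem_image_of_mem _ hp))⟩
  complete := fun n φ c => q.complete n (φ.relabel (Sum.map e id)) c

theorem GlobalType.FinSatInM.of_subst {α : Type v} {β : Type w} {q : GlobalType L 𝕄 β}
    (hq : q.FinSatInM Ms) {r : GlobalType L 𝕄 α} {e : α → β}
    (hr : ∀ p ∈ r.carrier, p.subst e ∈ q.carrier) : r.FinSatInM Ms := by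
  classical
  intro t ht
  obtain ⟨m, hm, h⟩ := hq (t.image (FmlP.subst e))
    (by rw [Finset.coe_image]; exact Set.image_subset_iff.2 fun p hp => hr p (ht hp))
  exact ⟨m ∘ e, fun i => hm _,
    fun p hp => (p.realize_subst e m).1 (h _ (Finset.mem_image_of_mem _ hp))⟩

theorem RealizesType.comp {α : Type v} {β : Type w} {q : GlobalType L 𝕄 β} {r : GlobalType L 𝕄 α}
    {e : α → β} (hr : ∀ p ∈ r.carrier, p.subst e ∈ q.carrier) {a : β → 𝕄} {C : Set 𝕄}
    (h : RealizesType q a C) : RealizesType r (a ∘ e) C :=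
  fun n φ c hc hφ => (FmlP.realize_subst e ⟨n, φ, c⟩ a).1 (h n _ c hc (hr _ hφ))

/-- A coheir of `tp(Y ∘ e / Ms)` lifts to a coheir of `tp(Y / Ms)`. -/
theorem exists_lift_globalType (hMs : IsElemSubmodel L Ms) {q : GlobalType L 𝕄 α}
    (hq : q.FinSatInM Ms) {e : α → ξ} (he : Function.Injective e) {Y : ξ → 𝕄}
    (hqY : ExtendsTpOver q Ms (Y ∘ e)) :
    ∃ r : GlobalType L 𝕄 ξ, r.FinSatInM Ms ∧ ExtendsTpOver r Ms Y ∧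
      ∀ p ∈ q.carrier, p.subst e ∈ r.carrier := by
  classical
  obtain ⟨S, rfl⟩ := hMs
  let T : Set (FmlP L 𝕄 ξ) :=
    {p | (∀ i, p.2.2 i ∈ (S : Set 𝕄)) ∧ p.2.1.Realize (Sum.elim Y p.2.2)}
  obtain ⟨r, hr, hΓ⟩ := exists_globalType (Ms := (S : Set 𝕄)) (T ∪ FmlP.subst e '' q.carrier) (by
    intro t ht
    obtain ⟨t', ht', htt'⟩ := Finset.subset_set_image_iff.1
      (show ((t.filter (· ∉ T) : Finset _) : Set _) ⊆ FmlP.subst e '' q.carrier from fun p hp => by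
        rw [Finset.mem_coe, Finset.mem_filter] at hp
        exact (ht hp.1).resolve_left hp.2)
    obtain ⟨⟨n, φ, c⟩, hp, hp'⟩ := exists_conj (t.filter (· ∈ T))
    have hc : ∀ i, c i ∈ (S : Set 𝕄) := by
      intro i
      obtain ⟨p', hp't, j, h⟩ := hp i
      rw [show c i = _ from h]
      exact (Finset.mem_filter.1 hp't).2.1 j
    have hφY : φ.Realize (Sum.elim Y c) := (hp' Y).2 fun p hp => (Finset.mem_filter.1 hp).2.2
    obtain ⟨θ, hθ⟩ := exists_projection_formula he φ
    have hθq := hqY n θ c hc ((hθ 𝕄 (fun z => ⟨Y z⟩) _ _).2 ⟨Y, rfl, hφY⟩)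
    obtain ⟨m, hm, hmt⟩ := hq (insert ⟨n, θ, c⟩ t') (by
      rw [Finset.coe_insert]
      exact Set.insert_subset hθq ht')
    let mS : α → S := fun a => ⟨m a, hm a⟩
    let cS : Fin n → S := fun i => ⟨c i, hc i⟩
    have hsub : ∀ {γ : Type u} (ψ : L.Formula (γ ⊕ Fin n)) (y : γ → S),
        ψ.Realize (Sum.elim y cS) ↔ ψ.Realize (Sum.elim (fun z => (y z : 𝕄)) c) := by
      intro γ ψ y
      rw [← S.subtype.map_formula ψ, Sum.comp_elim]
      rfl
    have hθS : θ.Realize (Sum.elim mS cS) :=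
      (hsub θ mS).2 (hmt ⟨n, θ, c⟩ (Finset.mem_insert_self _ _))
    obtain ⟨y, hy, hyφ⟩ := (hθ S (fun z => by
      have : Nonempty 𝕄 := ⟨Y z⟩
      exact S.elementarilyEquivalent.symm.nonempty) _ _).1 hθS
    refine ⟨fun z => y z, fun z => (y z).2, fun p hpt => ?_⟩
    by_cases hpT : p ∈ T
    · exact (hp' _).1 ((hsub φ y).1 hyφ) p (Finset.mem_filter.2 ⟨hpt, hpT⟩)
    · have : p ∈ t'.image (FmlP.subst e) := by
        rw [htt']
        exact Finset.mem_filter.2 ⟨hpt, hpT⟩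
      obtain ⟨p', hp't, rfl⟩ := Finset.mem_image.1 this
      rw [FmlP.realize_subst]
      have hy' : (fun z => (y z : 𝕄)) ∘ e = m := funext fun a => congrArg Subtype.val (congrFun hy a)
      rw [hy']
      exact hmt p' (Finset.mem_insert_of_mem hp't))
  exact ⟨r, hr, fun n φ c hc h => hΓ (Or.inl ⟨hc, h⟩),
    fun p hp => hΓ (Or.inr (Set.mem_image_of_mem _ hp))⟩

/-- A type finitely satisfiable in `Ms` has a global extension with the same property. -/
theorem FinSatIn.exists_globalType {a : α → 𝕄} {C : Set 𝕄} (h : FinSatIn L Ms a C) :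
    ∃ r : GlobalType L 𝕄 α, r.FinSatInM Ms ∧ ExtendsTpOver r C a := by
  obtain ⟨r, hr, hΓ⟩ := NSOP2Paper.exists_globalType (Ms := Ms)
    {p : FmlP L 𝕄 α | (∀ i, p.2.2 i ∈ C) ∧ p.2.1.Realize (Sum.elim a p.2.2)}
    fun t ht => h.exists_of_finset t (fun p hp => (ht hp).1) fun p hp => (ht hp).2
  exact ⟨r, hr, fun n φ c hc h => hΓ ⟨hc, h⟩⟩

theorem exists_realizesType {κ : Cardinal.{u}} (hmonster : IsMonster L 𝕄 κ)
    (hξ : Cardinal.mk ξ < κ) (r : GlobalType L 𝕄 ξ) {A : Set 𝕄} (hA : Cardinal.mk A < κ) :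
    ∃ x : ξ → 𝕄, RealizesType r x A := by
  obtain ⟨x, hx⟩ := hmonster.2.1 ξ A hξ hA {p ∈ r.carrier | ∀ i, p.2.2 i ∈ A} (fun p hp => hp.2)
    fun t ht => r.consistent t fun p hp => (ht hp).1
  exact ⟨x, fun n φ c hc h => hx ⟨n, φ, c⟩ ⟨h, hc⟩⟩

theorem mk_union_range_lt {κ : Cardinal.{u}} (hmonster : IsMonster L 𝕄 κ)
    (hMs : Cardinal.mk Ms < κ) (hξ : Cardinal.mk ξ < κ) (a : ξ → 𝕄) :
    Cardinal.mk ↥(Ms ∪ Set.range a) < κ :=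
  (Cardinal.mk_union_le _ _).trans_lt
    (Cardinal.add_lt_of_lt hmonster.1.le hMs (Cardinal.mk_range_le.trans_lt hξ))

theorem mk_nat_prod_lt {κ : Cardinal.{u}} (hmonster : IsMonster L 𝕄 κ)
    (hξ : Cardinal.mk ξ < κ) : Cardinal.mk (ℕ × ξ) < κ := by
  simpa using Cardinal.mul_lt_of_lt hmonster.1.le hmonster.1 hξ

theorem exists_morleyIn {κ : Cardinal.{u}} (hmonster : IsMonster L 𝕄 κ)
    (hMs : Cardinal.mk Ms < κ) (hξ : Cardinal.mk ξ < κ) {r : GlobalType L 𝕄 ξ}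
    (hr : r.FinSatInM Ms) : ∃ I : ℕ → ξ → 𝕄, MorleyIn r Ms I := by
  have h : ∀ A : Set 𝕄, ∃ x : ξ → 𝕄, Cardinal.mk A < κ → RealizesType r x A := by
    intro A
    by_cases hA : Cardinal.mk A < κ
    · exact (exists_realizesType hmonster hξ r hA).imp fun _ hx _ => hx
    · exact (r.consistent ∅ (by simp)).imp fun _ _ h => absurd h hA
  choose g hg using h
  let I : ℕ → ξ → 𝕄 := fun i => Nat.strongRec (motive := fun _ => ξ → 𝕄)
    (fun i f => g (Ms ∪ ⋃ (j : ℕ) (h : j < i), Set.range (f j h))) i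
  have hI : ∀ i, I i = g (Ms ∪ ⋃ (j : ℕ) (_ : j < i), Set.range (I j)) := fun i => by
    simp only [I]
    rw [Nat.strongRec_eq]
  refine ⟨I, hr, fun i => ?_⟩
  rw [hI]
  refine hg _ ((Cardinal.mk_le_mk_of_subset (Set.union_subset_union_right Ms ?_)).trans_lt
    (mk_union_range_lt hmonster hMs (mk_nat_prod_lt hmonster hξ) (flatSeq I)))
  refine Set.iUnion₂_subset fun j _ => ?_
  rintro _ ⟨z, rfl⟩
  exact ⟨(j, z), rfl⟩

/-- Over every small tuple there is a `R`-independent copy of `X`, all of whose subtuples given by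
`E` realize `q` over it. -/
def HasIndepCopies (R : IndRel L 𝕄) (κ : Cardinal.{u}) (Ms : Set 𝕄) (q : GlobalType L 𝕄 α)
    (X : ξ → 𝕄) (E : Set (α → ξ)) : Prop :=
  ∀ β : Type u, Cardinal.mk β < κ → ∀ a : β → 𝕄, ∃ X' : ξ → 𝕄, EqTpOver L Ms X' X ∧
    R.rel (Set.range a) Ms (Set.range X') ∧
    ∀ e ∈ E, RealizesType q (X' ∘ e) (Ms ∪ Set.range a)

theorem IsCanonicalGlobal.hasIndepCopies {κ : Cardinal.{u}} (hmonster : IsMonster L 𝕄 κ)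
    {R : IndRel L 𝕄} (hMs : Cardinal.mk Ms < κ) (hα : Cardinal.mk α < κ)
    {q : GlobalType L 𝕄 α} (hq : IsCanonicalGlobal R κ Ms q) {b : α → 𝕄}
    (hqb : ExtendsTpOver q Ms b) : HasIndepCopies R κ Ms q b {id} := by
  intro β hβ a
  obtain ⟨x, hx⟩ := exists_realizesType hmonster hα q (mk_union_range_lt hmonster hMs hβ a)
  exact ⟨x, hx.eqTpOver Set.subset_union_left hqb, hq β hβ a x hx, by simpa using hx⟩

/-- Independent copies yield a coheir of `tp(X / Ms)` extending `q` in all the subtuples. -/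
theorem HasIndepCopies.exists_globalType {κ : Cardinal.{u}} (hmonster : IsMonster L 𝕄 κ)
    {R : IndRel L 𝕄} (hR : R.StrongerThanH) (hMs : IsElemSubmodel L Ms)
    {q : GlobalType L 𝕄 α} {X : ξ → 𝕄} {E : Set (α → ξ)} (h : HasIndepCopies R κ Ms q X E) :
    ∃ r : GlobalType L 𝕄 ξ, r.FinSatInM Ms ∧ ExtendsTpOver r Ms X ∧
      ∀ e ∈ E, ∀ p ∈ q.carrier, p.subst e ∈ r.carrier := by
  obtain ⟨r, hr, hΓ⟩ := NSOP2Paper.exists_globalType (Ms := Ms)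
    ({p : FmlP L 𝕄 ξ | (∀ i, p.2.2 i ∈ Ms) ∧ p.2.1.Realize (Sum.elim X p.2.2)} ∪
      {p | ∃ e ∈ E, ∃ p' ∈ q.carrier, p'.subst e = p}) (by
    intro t ht
    let A : Set 𝕄 := ⋃ p ∈ t, Set.range p.2.2
    have hA : A.Finite := t.finite_toSet.biUnion fun p _ => Set.finite_range _
    have htA : ∀ p ∈ t, ∀ i, p.2.2 i ∈ A := fun p hp i => Set.mem_biUnion hp ⟨i, rfl⟩
    obtain ⟨X', hX', hind, hE⟩ := h A (hA.lt_aleph0.trans hmonster.1) Subtype.val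
    rw [Subtype.range_coe] at hind hE
    refine ((hR _ _ _ hMs hind).comp (Set.rangeFactorization X')).exists_of_finset t
      (fun p hp i => Or.inr (htA p hp i)) fun p hp => ?_
    rcases ht hp with ⟨hc, hφ⟩ | ⟨e, he, p', hp', rfl⟩
    · exact (hX' _ _ _ hc).2 hφ
    · exact (p'.realize_subst e X').2
        (hE e he _ _ _ (fun i => Or.inr (htA _ hp i)) hp'))
  exact ⟨r, hr, fun n φ c hc h => hΓ (Or.inl ⟨hc, h⟩),
    fun e he p hp => hΓ (Or.inr ⟨e, he, p, hp, rfl⟩)⟩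

theorem HasIndepCopies.eqTpOver {κ : Cardinal.{u}} (hmonster : IsMonster L 𝕄 κ)
    {R : IndRel L 𝕄} {q : GlobalType L 𝕄 α} {X : ξ → 𝕄} {E : Set (α → ξ)}
    (h : HasIndepCopies R κ Ms q X E) {b : α → 𝕄} (hqb : ExtendsTpOver q Ms b) {e : α → ξ}
    (he : e ∈ E) : EqTpOver L Ms (X ∘ e) b := by
  obtain ⟨X', hX', -, hE⟩ := h PEmpty (by
    simpa using Cardinal.aleph0_pos.trans hmonster.1) PEmpty.elim
  exact (hX'.symm.comp e).trans ((hE e he).eqTpOver Set.subset_union_left hqb)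

theorem HasIndepCopies.mono {κ : Cardinal.{u}} {R : IndRel L 𝕄} {q : GlobalType L 𝕄 α}
    {X : ξ → 𝕄} {E E' : Set (α → ξ)} (h : HasIndepCopies R κ Ms q X E) (hE : E' ⊆ E) :
    HasIndepCopies R κ Ms q X E' := fun β hβ a =>
  (h β hβ a).imp fun _ hX' => ⟨hX'.1, hX'.2.1, fun e he => hX'.2.2 e (hE he)⟩

/-- Being a coheir Morley sequence in a given type only depends on the type over the base. -/
theorem MorleyIn.congr {α : Type v} {r : GlobalType L 𝕄 α} {I I' : ℕ → α → 𝕄}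
    (h : MorleyIn r Ms I) (hI : EqTpOver L Ms (flatSeq I) (flatSeq I')) : MorleyIn r Ms I' := by
  have hS : ∀ (J : ℕ → α → 𝕄) (i : ℕ),
      (⋃ (j : ℕ) (_ : j < i), Set.range (J j)) = flatSeq J '' {p | p.1 < i} := by
    intro J i
    ext x
    simp [flatSeq]
  refine ⟨h.1, fun i => ?_⟩
  have := h.2 i
  rw [hS] at this ⊢
  exact this.transport h.1 hI (fun a => (i, a)) _

/-- By the coheir chain condition, having independent copies passes to coheir Morley sequences. -/
theorem HasIndepCopies.flatSeq {κ : Cardinal.{u}} (hmonster : IsMonster L 𝕄 κ)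
    {R : IndRel L 𝕄} (hR : R.CoheirChain κ) (hMs : IsElemSubmodel L Ms)
    (hMs' : Cardinal.mk Ms < κ) (hξ : Cardinal.mk ξ < κ)
    {q : GlobalType L 𝕄 α} {X : ξ → 𝕄} {E : Set (α → ξ)} (h : HasIndepCopies R κ Ms q X E)
    {I : ℕ → ξ → 𝕄} (hI : CoheirMorley L Ms I) (hI0 : EqTpOver L Ms (I 0) X) :
    HasIndepCopies R κ Ms q (flatSeq I) {e' | ∃ (i : ℕ), ∃ e ∈ E, e' = fun x => (i, e x)} := by
  intro β hβ a
  obtain ⟨X', hX', hind, hE⟩ := h β hβ a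
  obtain ⟨σ, hσ, hσI⟩ := exists_equiv_of_eqTpOver hmonster hMs' hξ (hI0.trans hX'.symm)
  have hσI' : EqTpOver L Ms (NSOP2Paper.flatSeq fun i => σ ∘ I i) (NSOP2Paper.flatSeq I) :=
    eqTpOver_equiv σ hσ (NSOP2Paper.flatSeq I)
  obtain ⟨r, hr⟩ := hI
  obtain ⟨I', hI', hind', hI'X⟩ := hR Ms hMs hMs' β ξ hβ hξ a X' hind (fun i => σ ∘ I i)
    ⟨r, hr.congr hσI'.symm⟩ hσI
  refine ⟨NSOP2Paper.flatSeq I', hI'.trans hσI', ?_, ?_⟩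
  · convert hind' using 1
    ext x
    simp [NSOP2Paper.flatSeq]
  · rintro _ ⟨i, e, he, rfl⟩ n φ c hc hφ
    exact ((hI'X i).comp e n φ c hc).2 (hE e he n φ c hc hφ)

theorem MorleyIn.comap {α : Type v} {β : Type w} {r : GlobalType L 𝕄 β} {I : ℕ → β → 𝕄}
    (h : MorleyIn r Ms I) (e : α → β) : MorleyIn (r.comap e) Ms fun i => I i ∘ e :=
  ⟨h.1.of_subst fun _ hp => hp, fun i => ((h.2 i).comp fun _ hp => hp).mono
    (Set.union_subset_union_right _
      (Set.iUnion₂_mono fun j _ => Set.range_comp_subset_range e (I j)))⟩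

theorem ExtendsTpOver.realizesType {α : Type v} {q : GlobalType L 𝕄 α} {a : α → 𝕄} {C : Set 𝕄}
    (h : ExtendsTpOver q C a) : RealizesType q a C := by
  classical
  intro n φ c hc hφ
  by_contra hn
  obtain ⟨m, hm⟩ := q.consistent {⟨n, φ, c⟩, ⟨n, φ.not, c⟩} (by
    simpa [Set.insert_subset_iff, hφ] using h n φ.not c hc hn)
  exact hm ⟨n, φ.not, c⟩ (by simp) (hm ⟨n, φ, c⟩ (by simp))

/-! ### Descending combs -/

section Combs

variable {A : Type w} [DecidableEq A]

theorem meet_cons_self (t : A) (x y : List A) : meet (t :: x) (t :: y) = t :: meet x y := by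
  simp [meet]

theorem exists_cons_of_meet_ne_nil {x y : List A} (h : meet x y ≠ []) :
    ∃ t x' y', x = t :: x' ∧ y = t :: y' ∧ meet x y = t :: meet x' y' := by
  rcases x with _ | ⟨a, x⟩
  · simp [meet] at h
  rcases y with _ | ⟨b, y⟩
  · simp [meet] at h
  by_cases hab : a = b
  · subst hab
    exact ⟨a, x, y, rfl, rfl, meet_cons_self _ _ _⟩
  · simp [meet, hab] at h

theorem foldl_meet_cons (t : A) (x : List A) (l : List (List A)) :
    (l.map (t :: ·)).foldl meet (t :: x) = t :: l.foldl meet x := by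
  induction l generalizing x with
  | nil => rfl
  | cons y l ih => simp only [List.map_cons, List.foldl_cons, meet_cons_self, ih]

theorem exists_head_of_foldl_meet_ne_nil {x : List A} {l : List (List A)}
    (h : l.foldl meet x ≠ []) : ∃ t, (∃ x', x = t :: x') ∧ ∀ y ∈ l, ∃ y', y = t :: y' := by
  induction l generalizing x with
  | nil =>
    obtain ⟨t, x', rfl⟩ := List.exists_cons_of_ne_nil (l := x) h
    exact ⟨t, ⟨x', rfl⟩, by simp⟩
  | cons y l ih =>
    obtain ⟨t, ⟨z, hz⟩, hl⟩ := ih h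
    obtain ⟨s, x', y', rfl, rfl, hm⟩ := exists_cons_of_meet_ne_nil (by rw [hz]; simp)
    obtain ⟨rfl, -⟩ := List.cons.inj (hm.symm.trans hz)
    exact ⟨s, ⟨x', rfl⟩, by simpa using hl⟩

theorem combMeet_cons {k : ℕ} (t : A) (τ : Fin k → List A) (i : Fin k) :
    combMeet (fun j => t :: τ j) i = t :: combMeet τ i := by
  rw [combMeet, combMeet, ← foldl_meet_cons, List.map_ofFn]
  rfl

theorem exists_head_of_combMeet_ne_nil {k : ℕ} {η : Fin k → List A} {i : Fin k}
    (h : combMeet η i ≠ []) : ∃ t, ∀ j ≤ i, ∃ y, η j = t :: y := by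
  obtain ⟨t, hi, hl⟩ := exists_head_of_foldl_meet_ne_nil h
  refine ⟨t, fun j hj => ?_⟩
  rcases hj.lt_or_eq with hj | rfl
  · exact hl _ (List.mem_ofFn.2 ⟨⟨j, hj⟩, rfl⟩)
  · exact hi

theorem DescendingComb.of_cons [Preorder A] {k : ℕ} {t : A} {τ : Fin k → List A}
    (h : DescendingComb fun j => t :: τ j) : DescendingComb τ := by
  refine ⟨fun i j hij hp => h.1 i j hij ((List.prefix_cons_inj t).2 hp), fun i j hij => ?_,
    fun i hi => ?_⟩
  · rcases h.2.1 i j hij with _ | h' | h'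
    · exact absurd h' (lt_irrefl t)
    · exact h'
  · have := h.2.2 i hi
    simpa [combMeet_cons, List.prefix_cons_inj] using this

/-- A descending comb either lies above one child of the root, or its last element lies above a
child to the right of the child below all other elements. -/
theorem DescendingComb.cases_head [Preorder A] {m : ℕ} {η : Fin (m + 2) → List A}
    (h : DescendingComb η) :
    ∃ (t s : A) (τ : Fin (m + 2) → List A), (∀ j : Fin (m + 1), η j.castSucc = t :: τ j.castSucc) ∧
      η (Fin.last _) = s :: τ (Fin.last _) ∧ (s = t ∨ t < s) := by
  have hne : combMeet η (Fin.last m).castSucc ≠ [] := by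
    intro h0
    obtain ⟨h1, h2⟩ := h.2.2 m (by omega)
    rw [show (⟨m, by omega⟩ : Fin (m + 2)) = (Fin.last m).castSucc from rfl, h0] at h1 h2
    exact h2 (List.prefix_nil.1 h1)
  obtain ⟨t, ht⟩ := exists_head_of_combMeet_ne_nil hne
  have ht' : ∀ j : Fin (m + 1), ∃ y, η j.castSucc = t :: y :=
    fun j => ht _ (Fin.castSucc_le_castSucc_iff.2 (Fin.le_last j))
  obtain ⟨s, y, hs⟩ : ∃ s y, η (Fin.last _) = s :: y :=
    List.exists_cons_of_ne_nil fun h0 => h.1 (Fin.last _) (Fin.last m).castSucc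
      (Fin.castSucc_lt_last _).ne' (by rw [h0]; exact List.nil_prefix)
  refine ⟨t, s, fun j => (η j).tail, fun j => ?_, by simp [hs], ?_⟩
  · obtain ⟨y, hy⟩ := ht' j
    simp [hy]
  · obtain ⟨z, hz⟩ := ht' (Fin.last m)
    have := h.2.1 _ _ (Fin.castSucc_lt_last (Fin.last m))
    rw [hs, hz] at this
    rcases this with _ | h' | _
    · exact Or.inr h'
    · exact Or.inl rfl

theorem DescendingComb.castLE [LT A] {k l : ℕ} (hkl : k ≤ l) {η : Fin l → List A}
    (h : DescendingComb η) : DescendingComb fun i => η (Fin.castLE hkl i) :=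
  ⟨fun _ _ hij => h.1 _ _ fun h' => hij (Fin.castLE_injective hkl h'),
    fun _ _ hij => h.2.1 _ _ hij, fun i hi => h.2.2 i (hi.trans_le hkl)⟩

end Combs

/-! ### Coheir trees -/

/-- `c`, restricted to the nodes of length at most `n`, is a coheir tree along the coheirs `Q`,
whose paths realize `tp(b 0 … b n / Ms)` and whose descending combs are Morley in `q`. -/
structure IsCoheirTree {α : Type v} (Ms : Set 𝕄) (q : GlobalType L 𝕄 α)
    (Q : ℕ → GlobalType L 𝕄 α) (b : ℕ → α → 𝕄) (n : ℕ) (c : List ℕ → α → 𝕄) : Prop where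
  morley : ∀ μ : List ℕ, μ.length < n →
    CoheirMorley L Ms fun i (p : List ℕ × α) => c (μ ++ i :: p.1) p.2
  node : ∀ (j : ℕ) (μ : List ℕ), μ.length + j = n → RealizesType (Q j) (c μ)
    (Ms ∪ Function.uncurry c '' {p | ∃ ν : List ℕ, ν ≠ [] ∧ ν.length ≤ j ∧ p.1 = μ ++ ν})
  path : ∀ l : List ℕ, l.length = n → EqTpOver L Ms
    (fun p : Fin (n + 1) × α => c (l.take (n - p.1)) p.2) (fun p => b p.1 p.2)
  comb : ∀ (k : ℕ) (η : Fin (k + 1) → List ℕ), (∀ i, (η i).length ≤ n) → DescendingComb η →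
    RealizesType q (c (η (Fin.last k)))
      (Ms ∪ Function.uncurry c '' {p | ∃ j : Fin k, p.1 = η j.castSucc})

/-- The tree with root `x` and the subtrees `K i` above its children. -/
def consTree {X : Type*} (x : X) (K : ℕ → List ℕ → X) : List ℕ → X
  | [] => x
  | i :: l => K i l

theorem IsCoheirTree.congr {α : Type v} {q : GlobalType L 𝕄 α} {Q : ℕ → GlobalType L 𝕄 α}
    {b : ℕ → α → 𝕄} {n : ℕ} {c c' : List ℕ → α → 𝕄} (h : IsCoheirTree Ms q Q b n c)
    (hq : q.FinSatInM Ms) (hQ : ∀ j ≤ n, (Q j).FinSatInM Ms)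
    (hc : EqTpOver L Ms (Function.uncurry c) (Function.uncurry c')) :
    IsCoheirTree Ms q Q b n c' where
  morley μ hμ := by
    obtain ⟨r, hr⟩ := h.morley μ hμ
    exact ⟨r, hr.congr (hc.comp fun p : ℕ × List ℕ × α => (μ ++ p.1 :: p.2.1, p.2.2))⟩
  node j μ hj := (h.node j μ hj).transport (hQ j (by omega)) hc (fun a => (μ, a)) _
  path l hl := (hc.comp fun p : Fin (n + 1) × α => (l.take (n - p.1), p.2)).symm.trans (h.path l hl)
  comb k η hη hcomb := (h.comb k η hη hcomb).transport hq hc (fun a => (η (Fin.last k), a)) _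

theorem isCoheirTree_zero {α : Type v} {q : GlobalType L 𝕄 α} {Q : ℕ → GlobalType L 𝕄 α}
    {b : ℕ → α → 𝕄} (hq : RealizesType q (b 0) Ms) (hQ : RealizesType (Q 0) (b 0) Ms) :
    IsCoheirTree Ms q Q b 0 fun _ => b 0 where
  morley μ hμ := absurd hμ (Nat.not_lt_zero _)
  node j μ hj := by
    obtain rfl : j = 0 := by omega
    refine hQ.mono (Set.union_subset subset_rfl ?_)
    rintro _ ⟨p, ⟨ν, hν, hν0, -⟩, rfl⟩
    exact absurd (List.length_eq_zero_iff.1 (Nat.le_zero.1 hν0)) hν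
  path l hl := by
    intro n φ c _
    apply iff_of_eq
    congr 2
    funext p
    simp
  comb k η hη hcomb := by
    refine hq.mono (Set.union_subset subset_rfl ?_)
    rintro _ ⟨p, ⟨j, -⟩, rfl⟩
    refine absurd ?_ (hcomb.1 j.castSucc (Fin.last k) (Fin.castSucc_lt_last j).ne)
    rw [List.length_eq_zero_iff.1 (Nat.le_zero.1 (hη j.castSucc))]
    exact List.nil_prefix

theorem IsCoheirTree.cons {α : Type v} {q : GlobalType L 𝕄 α} {Q : ℕ → GlobalType L 𝕄 α}
    {b : ℕ → α → 𝕄} {n : ℕ} {x : α → 𝕄} {K : ℕ → List ℕ → α → 𝕄}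
    (hK : ∀ i, IsCoheirTree Ms q Q b n (K i))
    (hmorley : CoheirMorley L Ms fun i => Function.uncurry (K i))
    (hsep : ∀ i l, RealizesType q (K i l)
      (Ms ∪ ⋃ (j : ℕ) (_ : j < i), Set.range (Function.uncurry (K j))))
    (hx : RealizesType q x Ms) (hfin : (Q (n + 1)).FinSatInM Ms)
    (hb : ExtendsTpOver (Q (n + 1)) (Ms ∪ ⋃ (j : ℕ) (_ : j < n + 1), Set.range (b j)) (b (n + 1)))
    (hroot : RealizesType (Q (n + 1)) x (Ms ∪ ⋃ i, Set.range (Function.uncurry (K i)))) :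
    IsCoheirTree Ms q Q b (n + 1) (consTree x K) where
  morley μ hμ := by
    rcases μ with _ | ⟨i, μ⟩
    · exact hmorley
    · exact (hK i).morley μ (by simpa using hμ)
  node j μ hj := by
    rcases μ with _ | ⟨i, μ⟩
    · obtain rfl : j = n + 1 := by simpa using hj
      refine hroot.mono (Set.union_subset_union_right _ ?_)
      rintro _ ⟨⟨_, a⟩, ⟨ν, hν, -, rfl⟩, rfl⟩
      obtain ⟨i, ν, rfl⟩ := List.exists_cons_of_ne_nil hν
      exact Set.mem_iUnion.2 ⟨i, (ν, a), rfl⟩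
    · refine ((hK i).node j μ (by simp at hj; omega)).mono (Set.union_subset_union_right _ ?_)
      rintro _ ⟨⟨_, a⟩, ⟨ν, hν, hj, rfl⟩, rfl⟩
      exact ⟨(μ ++ ν, a), ⟨ν, hν, hj, rfl⟩, rfl⟩
  path l hl := by
    obtain ⟨i, l, rfl⟩ := List.exists_cons_of_length_eq_add_one hl
    have := RealizesType.eqTpOver_sumElim hfin ((hK i).path l (by simpa using hl))
      (hroot.mono (Set.union_subset_union_right _ ?_))
      (hb.realizesType.mono (Set.union_subset_union_right _ ?_))
    · convert this.comp fun p : Fin (n + 2) × α =>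
        if h : p.1.1 ≤ n then Sum.inr ((⟨p.1, Nat.lt_succ_of_le h⟩ : Fin (n + 1)), p.2) else Sum.inl p.2 using 1
      · funext ⟨j, a⟩
        by_cases h : j.1 ≤ n
        · have : n + 1 - j.1 = (n - j.1) + 1 := by omega
          simp [h, this, consTree]
        · have : n + 1 - j.1 = 0 := by omega
          simp [h, this, consTree]
      · funext ⟨j, a⟩
        by_cases h : j.1 ≤ n
        · simp [h]
        · have : j.1 = n + 1 := by omega
          simp [this]
    · rintro _ ⟨p, rfl⟩
      exact Set.mem_iUnion.2 ⟨i, (_, p.2), rfl⟩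
    · rintro _ ⟨p, rfl⟩
      exact Set.mem_iUnion₂.2 ⟨p.1, p.1.2, p.2, rfl⟩
  comb k η hη hcomb := by
    rcases k with _ | m
    · have : RealizesType q (consTree x K (η (Fin.last 0))) Ms := by
        rcases η (Fin.last 0) with _ | ⟨i, l⟩
        · exact hx
        · exact (hsep i l).mono Set.subset_union_left
      refine this.mono (Set.union_subset subset_rfl ?_)
      rintro _ ⟨p, ⟨j, -⟩, rfl⟩
      exact j.elim0
    · obtain ⟨t, s, τ, hτ, hs, rfl | hts⟩ := hcomb.cases_head
      · obtain rfl : η = fun j => s :: τ j := by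
          funext j
          induction j using Fin.lastCases with
          | last => exact hs
          | cast j => exact hτ j
        refine ((hK s).comb _ τ (fun i => by simpa using hη i) hcomb.of_cons).mono
          (Set.union_subset_union_right _ ?_)
        rintro _ ⟨⟨_, a⟩, ⟨j, rfl⟩, rfl⟩
        exact ⟨(τ j.castSucc, a), ⟨j, rfl⟩, rfl⟩
      · rw [hs]
        refine (hsep s _).mono (Set.union_subset_union_right _ ?_)
        rintro _ ⟨⟨_, a⟩, ⟨j, rfl⟩, rfl⟩
        rw [hτ]
        exact Set.mem_iUnion₂.2 ⟨t, hts, (τ j.castSucc, a), rfl⟩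

/-- The coheir tree is built by induction on its height, as part of a tuple having independent
copies whose nodes all realize `q`. -/
theorem exists_isCoheirTree {κ : Cardinal.{u}} (hmonster : IsMonster L 𝕄 κ) {R : IndRel L 𝕄}
    (hR : GoodRel R κ) (hMs : IsElemSubmodel L Ms) (hMs' : Cardinal.mk Ms < κ)
    (hα : Cardinal.mk α < κ) {q : GlobalType L 𝕄 α} (hqcan : IsCanonicalGlobal R κ Ms q)
    {b : ℕ → α → 𝕄} (hqb : ExtendsTpOver q Ms (b 0)) (n : ℕ)
    (hb : ∀ i ≤ n, FinSatIn L Ms (b i) (Ms ∪ ⋃ (j : ℕ) (_ : j < i), Set.range (b j)))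
    (hb0 : ∀ i ≤ n, EqTpOver L Ms (b i) (b 0)) :
    ∃ Q : ℕ → GlobalType L 𝕄 α,
      (∀ j ≤ n, (Q j).FinSatInM Ms ∧ ExtendsTpOver (Q j) Ms (b 0)) ∧
      ∃ (ξ : Type u) (X : ξ → 𝕄) (e : List ℕ → α → ξ), Cardinal.mk ξ < κ ∧
        (∀ l, Function.Injective (e l)) ∧ HasIndepCopies R κ Ms q X (Set.range e) ∧
        IsCoheirTree Ms q Q b n fun l => X ∘ e l := by
  have hR₁ := hR.1
  have hR₂ := hR.2.2.2.2.2
  have hbase := hqcan.hasIndepCopies hmonster hMs' hα hqb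
  have hqfin : q.FinSatInM Ms := by
    obtain ⟨r, hr, -, hrE⟩ := hbase.exists_globalType hmonster hR₁ hMs
    exact hr.of_subst (hrE id rfl)
  induction n with
  | zero =>
    refine ⟨fun _ => q, fun _ _ => ⟨hqfin, hqb⟩, α, b 0, fun _ => id, hα,
      fun _ => Function.injective_id, hbase.mono (by rintro _ ⟨_, rfl⟩; rfl), ?_⟩
    exact isCoheirTree_zero hqb.realizesType hqb.realizesType
  | succ n ih =>
    obtain ⟨Q, hQ, ξ, X, e, hξ, he, hX, htree⟩ :=
      ih (fun i hi => hb i (by omega)) (fun i hi => hb0 i (by omega))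
    obtain ⟨r, hr, hrX, hrE⟩ := hX.exists_globalType hmonster hR₁ hMs
    obtain ⟨I, hI⟩ := exists_morleyIn hmonster hMs' hξ hr
    have hIX : ∀ i, EqTpOver L Ms (I i) X := fun i =>
      (hI.2 i).eqTpOver Set.subset_union_left hrX
    have hY := hX.flatSeq hmonster hR₂ hMs hMs' hξ ⟨r, hI⟩ (hIX 0)
    obtain ⟨Q', hQ', hQ'b⟩ := (hb (n + 1) le_rfl).exists_globalType
    have hQ'0 : ExtendsTpOver Q' Ms (b 0) :=
      (hQ'b.mono Set.subset_union_left).congr (hb0 (n + 1) le_rfl).symm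
    have he0 : Function.Injective fun a : α => ((0 : ℕ), e [] a) := fun a a' h =>
      he [] (Prod.mk.inj h).2
    obtain ⟨r', hr', hr'Y, hr'Q⟩ := exists_lift_globalType hMs hQ' he0 (Y := flatSeq I)
      (hQ'0.congr (((hIX 0).comp (e [])).trans (hX.eqTpOver hmonster hqb ⟨[], rfl⟩)))
    obtain ⟨J, hJ⟩ := exists_morleyIn hmonster hMs' (mk_nat_prod_lt hmonster hξ) hr'
    have hJY : EqTpOver L Ms (J 0) (flatSeq I) :=
      (hJ.2 0).eqTpOver Set.subset_union_left hr'Y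
    have hZ := hY.flatSeq hmonster hR₂ hMs hMs' (mk_nat_prod_lt hmonster hξ) ⟨r', hJ⟩ hJY
    have hJI : MorleyIn r Ms fun i z => J 0 (i, z) := hI.congr hJY.symm
    let e' : List ℕ → α → ℕ × (ℕ × ξ) :=
      consTree (fun a => (1, 0, e [] a)) fun i l a => (0, i, e l a)
    have he' : Set.range e' ⊆ {e₂ | ∃ i : ℕ, ∃ e₁ ∈ {e₁ : α → ℕ × ξ | ∃ i : ℕ, ∃ e₀ ∈ Set.range e,
        e₁ = fun a => (i, e₀ a)}, e₂ = fun a => (i, e₁ a)} := by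
      rintro _ ⟨_ | ⟨i, l⟩, rfl⟩
      · exact ⟨1, _, ⟨0, _, ⟨[], rfl⟩, rfl⟩, rfl⟩
      · exact ⟨0, _, ⟨i, _, ⟨l, rfl⟩, rfl⟩, rfl⟩
    have hQ'' : ∀ j ≤ n, Function.update Q (n + 1) Q' j = Q j := fun j hj =>
      Function.update_of_ne (by omega) _ _
    have hQQ : ∀ j ≤ n + 1, (Function.update Q (n + 1) Q' j).FinSatInM Ms ∧
        ExtendsTpOver (Function.update Q (n + 1) Q' j) Ms (b 0) := by
      intro j hj
      rcases hj.lt_or_eq with hj | rfl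
      · rw [hQ'' j (by omega)]
        exact hQ j (by omega)
      · rw [Function.update_self]
        exact ⟨hQ', hQ'0⟩
    have hroot : RealizesType Q' (fun a => J 1 (0, e [] a)) (Ms ∪ Set.range (J 0)) :=
      ((hJ.2 1).comp hr'Q).mono
        (Set.union_subset_union_right _ (Set.subset_iUnion₂_of_subset 0 one_pos subset_rfl))
    refine ⟨Function.update Q (n + 1) Q', hQQ, ℕ × (ℕ × ξ), flatSeq J, e',
      mk_nat_prod_lt hmonster (mk_nat_prod_lt hmonster hξ), ?_, hZ.mono he', ?_⟩
    · rintro (_ | ⟨i, l⟩) a a' h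
      · exact he [] (Prod.mk.inj (Prod.mk.inj h).2).2
      · exact he l (Prod.mk.inj (Prod.mk.inj h).2).2
    · have hcons : (fun l => flatSeq J ∘ e' l) =
          consTree (fun a => J 1 (0, e [] a)) fun i l a => J 0 (i, e l a) := by
        funext l
        rcases l with _ | ⟨i, l⟩ <;> rfl
      rw [hcons]
      apply IsCoheirTree.cons
      · intro i
        have h := htree.congr hqfin (fun j hj => (hQ j hj).1)
          (c' := fun l a => J 0 (i, e l a)) (((hIX i).symm.trans
            (hJY.symm.comp fun z => (i, z))).comp fun p : List ℕ × α => e p.1 p.2)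
        exact ⟨h.morley, fun j μ hj => by rw [hQ'' j (by omega)]; exact h.node j μ hj, h.path,
          h.comb⟩
      · exact ⟨_, hJI.comap fun p : List ℕ × α => e p.1 p.2⟩
      · intro i l
        refine ((hJI.2 i).comp (hrE (e l) ⟨l, rfl⟩)).mono (Set.union_subset_union_right _
          (Set.iUnion₂_mono fun j _ => ?_))
        rintro _ ⟨p, rfl⟩
        exact ⟨e p.1 p.2, rfl⟩
      · exact fun k φ c hc h =>
          (hroot.eqTpOver Set.subset_union_left hQ'0 k φ c hc).2 (hqb.realizesType k φ c hc h)
      · exact (hQQ (n + 1) le_rfl).1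
      · rw [Function.update_self]
        exact hQ'b
      · rw [Function.update_self]
        refine hroot.mono (Set.union_subset_union_right _ (Set.iUnion_subset fun i => ?_))
        rintro _ ⟨p, rfl⟩
        exact ⟨(i, e p.1 p.2), rfl⟩

end CoheirTreeConstruction

/-- **Lemma 4.5.** Let `p(x) = tp(b₀/M)` be a type over `M`, `q(x)` a
canonical coheir extension of `p(x)`, and `b 0, …, b n` a coheir sequence over
`M` of realizations of `p`.  Then there is a coheir tree in `p` indexed by
`ω^{≤n}` such that every maximal path, read towards the root, realizes
`tp(b 0 … b n / M)`, and every descending comb, read in lexicographic order,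
consists of initial terms of a canonical Morley sequence in `q(x)`. -/
theorem coheir_tree_exists (L : FirstOrder.Language.{u, u}) (𝕄 : Type u)
    [L.Structure 𝕄] (κ : Cardinal.{u}) (hmonster : IsMonster L 𝕄 κ)
    (R : IndRel L 𝕄) (hCK : IsCK R κ)
    (Ms : Set 𝕄) (hMs : IsElemSubmodel L Ms) (hMssmall : Cardinal.mk Ms < κ)
    (α : Type u) (hα : Cardinal.mk α < κ)
    (n : ℕ) (b : Fin (n + 1) → α → 𝕄)
    (hcoheirseq : ∀ i : Fin (n + 1), FinSatIn L Ms (b i)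
      (Ms ∪ ⋃ (j : Fin (n + 1)) (_ : j < i), Set.range (b j)))
    (hrealizep : ∀ i, EqTpOver L Ms (b i) (b 0))
    (q : GlobalType L 𝕄 α) (hqp : ExtendsTpOver q Ms (b 0))
    (hqcan : IsCanonicalGlobal R κ Ms q) :
    ∃ c : {l : List ℕ // l.length ≤ n} → α → 𝕄,
      -- `c` is a tree of realizations of `p`:
      (∀ l, EqTpOver L Ms (c l) (b 0)) ∧
      -- coheir tree, condition (1): the sequence of subtrees above the
      -- children of any node of height `< n` is a coheir Morley sequence:
      (∀ (μ : List ℕ) (_ : μ.length < n),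
        CoheirMorley L Ms (fun i : ℕ =>
          subtreeTupleLen c (μ.length + 1) (μ ++ [i]) (by simp))) ∧
      -- coheir tree, condition (2): global coheir extensions `q_0, …, q_n`
      -- of `p`, with each node of height `n - m` realizing the restriction of
      -- `q_m` to `M` together with the part of the tree strictly above it:
      (∃ Q : Fin (n + 1) → GlobalType L 𝕄 α,
        (∀ j, (Q j).FinSatInM Ms ∧ ExtendsTpOver (Q j) Ms (b 0)) ∧
        ∀ (j : Fin (n + 1)) (μ : {l : List ℕ // l.length ≤ n}),
          μ.val.length = n - j.val →
          RealizesType (Q j) (c μ)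
            (Ms ∪ ⋃ (η : {l : List ℕ // l.length ≤ n})
              (_ : μ.val <+: η.val ∧ μ.val ≠ η.val), Set.range (c η))) ∧
      -- every maximal path, read towards the root, realizes `tp(b 0 … b n/M)`:
      (∀ l : {l : List ℕ // l.length ≤ n}, l.val.length = n →
        EqTpOver L Ms
          (fun p : Fin (n + 1) × α =>
            c ⟨l.val.take (n - p.1.val), by
              have := l.2; simp only [List.length_take]; omega⟩ p.2)
          (fun p : Fin (n + 1) × α => b p.1 p.2)) ∧
      -- every descending comb, read in lexicographic order, consists of
      -- initial terms of a canonical Morley sequence in `q`: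
      (∀ (k : ℕ) (η : Fin k → {l : List ℕ // l.length ≤ n}),
        DescendingComb (fun i => (η i).val) →
        ∀ i : Fin k, RealizesType q (c (η i))
          (Ms ∪ ⋃ (j : Fin k) (_ : j < i), Set.range (c (η j)))) := by
  let b' : ℕ → α → 𝕄 := fun i => if h : i < n + 1 then b ⟨i, h⟩ else b 0
  have hb' : ∀ p : Fin (n + 1), b' p = b p := fun p => dif_pos p.2
  obtain ⟨Q, hQ, ξ, X, e, -, -, hX, htree⟩ := exists_isCoheirTree (b := b') hmonster hCK.1 hMs
    hMssmall hα hqcan (hqp.congr (by rw [← hb' 0]; exact fun _ _ _ _ => Iff.rfl)) n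
    (fun i hi => by
      have hi' := hb' ⟨i, by omega⟩
      rw [show b' i = b ⟨i, by omega⟩ from hi']
      refine fun m φ c hc => hcoheirseq _ m φ c fun k =>
        Set.union_subset_union_right _ ?_ (hc k)
      rintro _ ⟨_, ⟨j, rfl⟩, _, ⟨hj, rfl⟩, a, rfl⟩
      exact Set.mem_iUnion₂.2 ⟨⟨j, by omega⟩, hj, a, (congrFun (hb' ⟨j, by omega⟩) a).symm⟩)
    (fun i hi => by
      rw [show b' i = b ⟨i, by omega⟩ from hb' ⟨i, by omega⟩, show b' 0 = b 0 from hb' 0]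
      exact hrealizep _)
  refine ⟨fun l => X ∘ e l.1, fun l => hX.eqTpOver hmonster hqp ⟨l.1, rfl⟩, fun μ hμ => ?_,
    ⟨fun j => Q j, fun j => ?_, fun j μ hμ => ?_⟩, fun l hl => ?_, fun k η hη i => ?_⟩
  · obtain ⟨r, hr⟩ := htree.morley μ hμ
    let f : {s : List ℕ // μ.length + 1 + s.length ≤ n} × α → List ℕ × α := fun p => (p.1.1, p.2)
    refine ⟨r.comap f, ?_⟩
    convert hr.comap f using 1
    funext i p
    simp [subtreeTupleLen, f]
  · have := hQ j (by omega)
    rwa [show b' 0 = b 0 from hb' 0] at this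
  · refine (htree.node j μ (by omega)).mono (Set.union_subset_union_right _ ?_)
    rintro _ ⟨_, ⟨η, rfl⟩, _, ⟨⟨⟨ν, hν⟩, hne⟩, rfl⟩, a, rfl⟩
    have hlen := η.2
    rw [← hν, List.length_append] at hlen
    exact ⟨(η.1, a), ⟨ν, fun h0 => hne (by simpa [h0] using hν), by omega, hν.symm⟩, rfl⟩
  · have := htree.path l.1 hl
    simp only [hb'] at this
    exact this
  · refine (htree.comb i (fun j => (η (Fin.castLE i.2 j)).1) (fun j => (η _).2)
      (hη.castLE i.2)).mono (Set.union_subset_union_right _ ?_)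
    rintro _ ⟨_, ⟨j, rfl⟩, _, ⟨hj, rfl⟩, a, rfl⟩
    exact ⟨((η j).1, a), ⟨⟨j, hj⟩, rfl⟩, rfl⟩

end NSOP2Paper
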